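/- Every aperiodic automorphism α of a unital Kirchberg algebra A (i.e., α^n is not inner for every n ∈ ℤ∖{0}) can be perturbed to an ergodic automorphism Ad u ∘ α by some unitary u ∈ A; that is, the fixed point algebra of the ℤ-action generated by Ad u ∘ α is ℂ1_A. -/

import Mathlib

/-!  Common definitions: group actions on C*-algebras, ergodicity, outerness,
states, conditional expectations, nuclearity, Kirchberg algebras, amenability. -/

noncomputable section

open scoped ComplexOrder MultiplierAlgebra

/-- An action of a group `G` on a (star) algebra `A` by ⋆-algebra automorphisms. -/
structure CStarAction (G A : Type) [Group G] [Add A] [Mul A] [SMul ℂ A] [Star A] where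
  app : G → A ≃⋆ₐ[ℂ] A
  app_one : ∀ a : A, app 1 a = a
  app_mul : ∀ (g h : G) (a : A), app (g * h) a = app g (app h a)

/-- The trivial action of `G` on `A`. -/
def trivialCStarAction (G A : Type) [Group G] [Add A] [Mul A] [SMul ℂ A] [Star A] :
    CStarAction G A where
  app _ := StarAlgEquiv.refl ℂ A
  app_one _ := rfl
  app_mul _ _ _ := rfl

/-- An automorphism of a unital C*-algebra is inner if it is `Ad u` for a unitary `u`. -/
def IsInnerAut {A : Type} [CStarAlgebra A] (φ : A ≃⋆ₐ[ℂ] A) : Prop :=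
  ∃ u : A, u ∈ unitary A ∧ ∀ a : A, φ a = u * a * star u

/-- The fixed point set of an action. -/
def CStarAction.fixedPoints {G A : Type} [Group G] [Add A] [Mul A] [SMul ℂ A] [Star A]
    (α : CStarAction G A) : Set A :=
  {a : A | ∀ g : G, α.app g a = a}

/-- An action on a unital C*-algebra is ergodic if its fixed point algebra is `ℂ1`. -/
def CStarAction.IsErgodic {G A : Type} [Group G] [CStarAlgebra A]
    (α : CStarAction G A) : Prop :=
  α.fixedPoints = Set.range (fun z : ℂ => z • (1 : A))

/-- An action is point-wise outer if `α g` is not inner for every `g ≠ 1`. -/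
def CStarAction.IsPointwiseOuter {G A : Type} [Group G] [CStarAlgebra A]
    (α : CStarAction G A) : Prop :=
  ∀ g : G, g ≠ 1 → ¬ IsInnerAut (α.app g)

/-- A state on a unital C*-algebra. -/
structure IsState {A : Type} [CStarAlgebra A] (φ : A →ₗ[ℂ] ℂ) : Prop where
  map_one : φ 1 = 1
  pos : ∀ a : A, 0 ≤ φ (star a * a)

/-- A `G`-invariant state. -/
structure IsInvariantState {G A : Type} [Group G] [CStarAlgebra A]
    (α : CStarAction G A) (φ : A →ₗ[ℂ] ℂ) extends IsState φ : Prop where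
  invariant : ∀ (g : G) (a : A), φ (α.app g a) = φ a

/-- A conditional expectation of `A` onto the subalgebra (given as the subset) `S`. -/
structure IsConditionalExpectation {A : Type} [NonUnitalCStarAlgebra A]
    (P : A →ₗ[ℂ] A) (S : Set A) : Prop where
  mem : ∀ a : A, P a ∈ S
  fixes : ∀ a ∈ S, P a = a
  contractive : ∀ a : A, ‖P a‖ ≤ ‖a‖
  positive : ∀ a : A, ∃ b : A, P (star a * a) = star b * b
  left_module : ∀ b ∈ S, ∀ a : A, P (b * a) = b * P a
  right_module : ∀ b ∈ S, ∀ a : A, P (a * b) = P a * b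

/-- Complete positivity of a linear map between star algebras (positivity of all
matrix amplifications, where positivity is witnessed algebraically). -/
def IsCompletelyPositive {A B : Type} [NonUnitalRing A] [StarRing A] [Module ℂ A]
    [NonUnitalRing B] [StarRing B] [Module ℂ B] (φ : A →ₗ[ℂ] B) : Prop :=
  ∀ (n : ℕ) (M : Matrix (Fin n) (Fin n) A), (∃ N : Matrix (Fin n) (Fin n) A, M = N.conjTranspose * N) →
    ∃ N' : Matrix (Fin n) (Fin n) B, M.map φ = N'.conjTranspose * N'

/-- Nuclearity of a C*-algebra, via the completely positive approximation property. -/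
def IsNuclearCStar (A : Type) [NonUnitalCStarAlgebra A] : Prop :=
  ∀ (s : Finset A) (ε : ℝ), 0 < ε →
    ∃ (n : ℕ) (φ : A →ₗ[ℂ] Matrix (Fin n) (Fin n) ℂ) (ψ : Matrix (Fin n) (Fin n) ℂ →ₗ[ℂ] A),
      IsCompletelyPositive φ ∧ IsCompletelyPositive ψ ∧ ∀ a ∈ s, ‖ψ (φ a) - a‖ < ε

/-- Simplicity: no non-trivial closed two-sided ideals (and `A ≠ 0`). -/
def IsSimpleCStarAlgebra (A : Type) [NonUnitalCStarAlgebra A] : Prop :=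
  (∃ a : A, a ≠ 0) ∧
    ∀ I : TwoSidedIdeal A, IsClosed (I : Set A) → (I : Set A) = {0} ∨ (I : Set A) = Set.univ

/-- A unital Kirchberg algebra: separable, nuclear, simple, purely infinite (UCT not assumed). -/
structure IsUnitalKirchberg (A : Type) [CStarAlgebra A] : Prop where
  separable : TopologicalSpace.SeparableSpace A
  nuclear : IsNuclearCStar A
  simple : IsSimpleCStarAlgebra A
  properly_infinite : ∃ s t : A, star s * s = 1 ∧ star t * t = 1 ∧ star s * t = 0
  purely_infinite : ∀ a : A, a ≠ 0 → ∃ x y : A, x * a * y = 1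

/-- A (possibly non-unital) Kirchberg algebra. -/
structure IsKirchberg (A : Type) [NonUnitalCStarAlgebra A] : Prop where
  separable : TopologicalSpace.SeparableSpace A
  nuclear : IsNuclearCStar A
  simple : IsSimpleCStarAlgebra A
  purely_infinite : ∀ a b : A, a ≠ 0 → ∀ ε : ℝ, 0 < ε → ∃ x y : A, ‖x * a * y - b‖ < ε

/-- Amenability of a discrete group: existence of a left invariant finitely additive mean. -/
def IsAmenableGroup (G : Type) [Group G] : Prop :=
  ∃ m : Set G → ℝ, (∀ s, 0 ≤ m s) ∧ m Set.univ = 1 ∧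
    (∀ s t : Set G, Disjoint s t → m (s ∪ t) = m s + m t) ∧
    ∀ (g : G) (s : Set G), m ((g * ·) '' s) = m s

/-- A projection in a C*-algebra. -/
def IsProjectionElem {A : Type} [NonUnitalCStarAlgebra A] (p : A) : Prop :=
  star p = p ∧ p * p = p

/-- An approximate unit consisting of a strictly increasing sequence of projections. -/
def HasIncreasingProjApproxUnit (A : Type) [NonUnitalCStarAlgebra A] : Prop :=
  ∃ p : ℕ → A, (∀ n, IsProjectionElem (p n)) ∧
    (∀ n, p n * p (n + 1) = p n ∧ p (n + 1) * p n = p n ∧ p n ≠ p (n + 1)) ∧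
    ∀ x : A, Filter.Tendsto (fun n => ‖x - p n * x‖ + ‖x - x * p n‖) Filter.atTop (nhds 0)

/-- `A` has a unit. -/
def IsUnitalAlgebra (A : Type) [NonUnitalCStarAlgebra A] : Prop :=
  ∃ e : A, ∀ x : A, e * x = x ∧ x * e = x

end
noncomputable section

open scoped MultiplierAlgebra

/-- A bundled C*-algebra with an action of the group `G` (a "G-C*-algebra"). -/
structure GCStar (G : Type) [Group G] where
  carrier : Type
  [inst : NonUnitalCStarAlgebra carrier]
  act : CStarAction G carrier

attribute [instance] GCStar.inst

/-- A `G`-equivariant ⋆-homomorphism between G-C*-algebras. -/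
structure GHom (G : Type) [Group G] (A B : GCStar G) where
  hom : A.carrier →⋆ₙₐ[ℂ] B.carrier
  equivariant : ∀ (g : G) (a : A.carrier), hom (A.act.app g a) = B.act.app g (hom a)

namespace GHom

variable {G : Type} [Group G]

/-- The identity equivariant homomorphism. -/
def id (A : GCStar G) : GHom G A A where
  hom :=
    { toFun := fun a => a
      map_smul' := fun _ _ => rfl
      map_zero' := rfl
      map_add' := fun _ _ => rfl
      map_mul' := fun _ _ => rfl
      map_star' := fun _ => rfl }
  equivariant _ _ := rfl

/-- Composition (in diagrammatic order: `f.comp g = g ∘ f`). -/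
def comp {A B C : GCStar G} (f : GHom G A B) (g : GHom G B C) : GHom G A C where
  hom := g.hom.comp f.hom
  equivariant h a := by
    simp only [NonUnitalStarAlgHom.comp_apply, f.equivariant, g.equivariant]

end GHom

/-- Forget the `G`-action, yielding an object over the trivial group `PUnit`. -/
def GCStar.forget {G : Type} [Group G] (A : GCStar G) : GCStar PUnit :=
  { carrier := A.carrier, inst := A.inst, act := trivialCStarAction PUnit A.carrier }

/-- Forget equivariance of a morphism. -/
def GHom.forget {G : Type} [Group G] {A B : GCStar G} (f : GHom G A B) :
    GHom PUnit A.forget B.forget :=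
  { hom := f.hom, equivariant := fun _ _ => rfl }

/-- An (abstract) equivariant Kasparov `KK^G`-theory: a category structure on
G-C*-algebras whose morphisms are the `KK^G`-groups, receiving equivariant
⋆-homomorphisms and classes of cocycle morphisms, together with suspension, Bott
periodicity, mapping cones and exact triangles. -/
structure KKTheoryG (G : Type) [Group G] where
  KK : GCStar G → GCStar G → Type
  instAddCommGroup : ∀ A B, AddCommGroup (KK A B)
  unit : (A : GCStar G) → KK A A
  comp : {A B C : GCStar G} → KK A B → KK B C → KK A C
  ofHom : {A B : GCStar G} → GHom G A B → KK A B
  ofCocycle : {A B : GCStar G} → (A.carrier →⋆ₙₐ[ℂ] B.carrier) →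
    (G → 𝓜(ℂ, B.carrier)) → KK A B
  comp_assoc : ∀ {A B C D : GCStar G} (x : KK A B) (y : KK B C) (z : KK C D),
    comp (comp x y) z = comp x (comp y z)
  unit_comp : ∀ {A B : GCStar G} (x : KK A B), comp (unit A) x = x
  comp_unit : ∀ {A B : GCStar G} (x : KK A B), comp x (unit B) = x
  ofHom_id : ∀ A : GCStar G, ofHom (GHom.id A) = unit A
  ofHom_comp : ∀ {A B C : GCStar G} (f : GHom G A B) (g : GHom G B C),
    ofHom (f.comp g) = comp (ofHom f) (ofHom g)
  ofCocycle_one : ∀ {A B : GCStar G} (f : GHom G A B),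
    ofCocycle f.hom (fun _ => 1) = ofHom f
  susp : GCStar G → GCStar G
  suspGHom : {A B : GCStar G} → GHom G A B → GHom G (susp A) (susp B)
  suspKK : {A B : GCStar G} → KK A B → KK (susp A) (susp B)
  bott : (A : GCStar G) → KK A (susp (susp A))
  bott_invertible : ∀ A : GCStar G,
    ∃ y : KK (susp (susp A)) A, comp (bott A) y = unit A ∧ comp y (bott A) = unit (susp (susp A))
  cone : {A B : GCStar G} → GHom G A B → GCStar G
  coneEval : {A B : GCStar G} → (f : GHom G A B) → GHom G (cone f) A
  coneIota : {A B : GCStar G} → (f : GHom G A B) → KK (susp B) (cone f)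
  coneJ : {A B J : GCStar G} → (f : GHom G A B) → (l : GHom G J A) →
    (∀ x, f.hom (l.hom x) = 0) → KK J (cone f)
  exactTriangle : {X A B : GCStar G} → KK (susp X) A → KK A B → KK B X → Prop
  triangle_cone : ∀ {A B : GCStar G} (f : GHom G A B),
    exactTriangle (coneIota f) (ofHom (coneEval f)) (ofHom f)

attribute [instance] KKTheoryG.instAddCommGroup

namespace KKTheoryG

variable {G : Type} [Group G]

/-- A class is a `KK^G`-equivalence if it is invertible for the Kasparov product. -/
def IsEquiv (kk : KKTheoryG G) {A B : GCStar G} (x : kk.KK A B) : Prop :=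
  ∃ y : kk.KK B A, kk.comp x y = kk.unit A ∧ kk.comp y x = kk.unit B

end KKTheoryG

/-- Non-equivariant `KK`-theory, seen as `KK`-theory over the trivial group. -/
abbrev KKTheory := KKTheoryG PUnit

/-- The forgetful functor `F : KK^G → KK`. -/
structure KKForget {G : Type} [Group G] (kkG : KKTheoryG G) (kk : KKTheory) where
  map : ∀ {A B : GCStar G}, kkG.KK A B → kk.KK A.forget B.forget
  map_ofHom : ∀ {A B : GCStar G} (f : GHom G A B), map (kkG.ofHom f) = kk.ofHom f.forget
  map_comp : ∀ {A B C : GCStar G} (x : kkG.KK A B) (y : kkG.KK B C),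
    map (kkG.comp x y) = kk.comp (map x) (map y)
  map_unit : ∀ A : GCStar G, map (kkG.unit A) = kk.unit A.forget

/-- The unital homomorphism `ℂ → A`, `z ↦ z • 1`. -/
def unitHomC (A : Type) [CStarAlgebra A] : ℂ →⋆ₙₐ[ℂ] A where
  toFun z := z • (1 : A)
  map_smul' z w := by simp [smul_smul]
  map_zero' := by simp
  map_add' z w := by simp [add_smul]
  map_mul' z w := by
    simp [smul_smul, smul_mul_smul_comm, mul_comm]
  map_star' z := by simp [star_smul, RCLike.star_def]

/-- Bundle an algebra with an action as a G-C*-algebra. -/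
abbrev GCStar.of (G : Type) [Group G] (A : Type) [NonUnitalCStarAlgebra A]
    (α : CStarAction G A) : GCStar G :=
  { carrier := A, act := α }

/-- `ℂ` as a G-C*-algebra with the trivial action. -/
abbrev GCStar.C (G : Type) [Group G] : GCStar G :=
  GCStar.of G ℂ (trivialCStarAction G ℂ)

lemma StarAlgEquiv.map_one' {A : Type} [CStarAlgebra A] (e : A ≃⋆ₐ[ℂ] A) : e 1 = 1 := by
  have h : e 1 * e 1 = e 1 := by rw [← map_mul]; simp
  have hsurj : Function.Surjective e := e.surjective
  have : ∀ y : A, e 1 * y = y := by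
    intro y
    obtain ⟨x, rfl⟩ := hsurj y
    calc e 1 * e x = e (1 * x) := (map_mul e 1 x).symm
    _ = e x := by rw [one_mul]
  have h1 := this 1
  rwa [mul_one] at h1

/-- The unit `ℂ → A` as an equivariant morphism for any action on a unital `A`. -/
def unitGHom {G : Type} [Group G] (A : Type) [CStarAlgebra A] (α : CStarAction G A) :
    GHom G (GCStar.C G) (GCStar.of G A α) where
  hom := unitHomC A
  equivariant g z := by
    have h : (α.app g) (z • (1 : A)) = z • (1 : A) := by
      rw [map_smul, StarAlgEquiv.map_one' (α.app g)]
    exact h.symm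

/-- A unital ⋆-homomorphism as an equivariant morphism for the trivial actions. -/
def toTrivGHom {A B : Type} [CStarAlgebra A] [CStarAlgebra B] (f : A →⋆ₐ[ℂ] B) :
    GHom PUnit (GCStar.of PUnit A (trivialCStarAction PUnit A))
      (GCStar.of PUnit B (trivialCStarAction PUnit B)) where
  hom := f.toNonUnitalStarAlgHom
  equivariant _ _ := rfl

/-- A ⋆-homomorphism as an equivariant morphism for the trivial actions. -/
def trivGHomOfHom {A B : Type} [NonUnitalCStarAlgebra A] [NonUnitalCStarAlgebra B]
    (f : A →⋆ₙₐ[ℂ] B) :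
    GHom PUnit (GCStar.of PUnit A (trivialCStarAction PUnit A))
      (GCStar.of PUnit B (trivialCStarAction PUnit B)) where
  hom := f
  equivariant _ _ := rfl

/-- Matrix-unit data exhibiting `BK` as the stabilization `B ⊗ K(ℓ²(ι))` of `B`:
`θ i j b` plays the role of `b ⊗ e_{i,j}`. -/
structure MatrixUnitsData (ι B BK : Type) [DecidableEq ι] [NonUnitalCStarAlgebra B]
    [NonUnitalCStarAlgebra BK] where
  θ : ι → ι → (B →ₗ[ℂ] BK)
  mul_rel : ∀ (i j k l : ι) (b c : B),
    θ i j b * θ k l c = if j = k then θ i l (b * c) else 0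
  star_rel : ∀ (i j : ι) (b : B), star (θ i j b) = θ j i (star b)
  norm_rel : ∀ (i j : ι) (b : B), ‖θ i j b‖ = ‖b‖
  dense : closure (Submodule.span ℂ (⋃ i : ι, ⋃ j : ι, Set.range (θ i j)) : Set BK) = Set.univ

/-- The corner embedding `B → B ⊗ K` associated to a fixed minimal projection,
built from matrix-unit data. -/
def MatrixUnitsData.cornerHom {ι B BK : Type} [DecidableEq ι] [NonUnitalCStarAlgebra B]
    [NonUnitalCStarAlgebra BK] (d : MatrixUnitsData ι B BK) (i : ι) : B →⋆ₙₐ[ℂ] BK where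
  toFun b := d.θ i i b
  map_smul' z b := by simp
  map_zero' := by simp
  map_add' b c := by simp
  map_mul' b c := by rw [d.mul_rel]; simp
  map_star' b := by rw [d.star_rel]

end
noncomputable section

/-! The standing assumptions of the Pimsner construction (Sec. 4.1 of the paper),
encoded as a structure: `B` unital separable nuclear, `E` separable non-unital
nuclear containing `B ⊗ K` as an essential ideal, a non-degenerate representation
`E ⊆ B(H)` and a compatible unitary representation of `G`, together with the
Toeplitz--Pimsner algebra `T_X` of the G-Hilbert bimodule `X = H ⊗ ℓ²(G) ⊗ E`
(presented by its creation operators `Tcr`), its gauge action and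
the quasi-free `G`-action `Γ`. -/
structure PimsnerSetting (G : Type) [Group G] [DecidableEq G] where
  B : Type
  [instB : CStarAlgebra B]
  sepB : TopologicalSpace.SeparableSpace B
  nucB : IsNuclearCStar B
  BK : Type
  [instBK : NonUnitalCStarAlgebra BK]
  stab : MatrixUnitsData ℕ B BK
  E : Type
  [instE : NonUnitalCStarAlgebra E]
  sepE : TopologicalSpace.SeparableSpace E
  nucE : IsNuclearCStar E
  nonunitalE : ¬ IsUnitalAlgebra E
  approxE : HasIncreasingProjApproxUnit E
  jBK : BK →⋆ₙₐ[ℂ] E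
  jBK_inj : Function.Injective jBK
  ideal_left : ∀ (x : E) (y : BK), x * jBK y ∈ Set.range jBK
  ideal_right : ∀ (x : E) (y : BK), jBK y * x ∈ Set.range jBK
  essential : ∀ x : E, (∀ y : BK, x * jBK y = 0) → x = 0
  H : Type
  [instH : NormedAddCommGroup H]
  [instH2 : InnerProductSpace ℂ H]
  [instH3 : CompleteSpace H]
  rep : E →⋆ₙₐ[ℂ] (H →L[ℂ] H)
  rep_inj : Function.Injective rep
  rep_nondeg : ∀ ζ : H, (∀ x : E, rep x ζ = 0) → ζ = 0
  U : G → (H →L[ℂ] H)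
  U_unitary : ∀ g, U g ∈ unitary (H →L[ℂ] H)
  U_mul : ∀ g h, U (g * h) = U g * U h
  αE : CStarAction G E
  αE_rep : ∀ g x, rep (αE.app g x) = U g * rep x * star (U g)
  αE_BK : ∀ g y, αE.app g (jBK y) ∈ Set.range jBK
  U_fix : ∀ g, U g * rep (jBK (stab.θ 0 0 1)) = rep (jBK (stab.θ 0 0 1))
  fix_U : ∀ g, rep (jBK (stab.θ 0 0 1)) * U g = rep (jBK (stab.θ 0 0 1))
  TX : Type
  [instTX : NonUnitalCStarAlgebra TX]
  ιE : E →⋆ₙₐ[ℂ] TX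
  ιE_inj : Function.Injective ιE
  Tcr : H → G → E → TX
  Tcr_addH : ∀ ζ ξ h x, Tcr (ζ + ξ) h x = Tcr ζ h x + Tcr ξ h x
  Tcr_smulH : ∀ (c : ℂ) ζ h x, Tcr (c • ζ) h x = c • Tcr ζ h x
  Tcr_addE : ∀ ζ h x y, Tcr ζ h (x + y) = Tcr ζ h x + Tcr ζ h y
  Tcr_right : ∀ ζ h x y, Tcr ζ h x * ιE y = Tcr ζ h (x * y)
  Tcr_left : ∀ a ζ h x, ιE a * Tcr ζ h x = Tcr (rep a ζ) h x
  Tcr_star : ∀ ζ h x ξ k y,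
    star (Tcr ζ h x) * Tcr ξ k y = if h = k then (inner ℂ ζ ξ : ℂ) • ιE (star x * y) else 0
  generates : closure ((NonUnitalStarAlgebra.adjoin ℂ
      {t : TX | ∃ ζ h x, t = Tcr ζ h x} : NonUnitalStarSubalgebra ℂ TX) : Set TX) = Set.univ
  vac : TX →ₗ[ℂ] E
  vac_ι : ∀ x, vac (ιE x) = x
  vac_creation : ∀ ζ h x t, vac (Tcr ζ h x * t) = 0
  vac_annihilation : ∀ ζ h x t, vac (t * star (Tcr ζ h x)) = 0
  vac_cr : ∀ ζ h x, vac (Tcr ζ h x) = 0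
  vac_positive : ∀ t, ∃ y, vac (star t * t) = star y * y
  vac_contractive : ∀ t, ‖vac t‖ ≤ ‖t‖
  gauge : CStarAction Circle TX
  gauge_cr : ∀ z ζ h x, gauge.app z (Tcr ζ h x) = (z : ℂ) • Tcr ζ h x
  gauge_ι : ∀ z x, gauge.app z (ιE x) = ιE x
  Γ : CStarAction G TX
  Γ_cr : ∀ g ζ h x, Γ.app g (Tcr ζ h x) = Tcr (U g ζ) (g * h) (αE.app g x)
  Γ_ι : ∀ g x, Γ.app g (ιE x) = ιE (αE.app g x)

attribute [instance] PimsnerSetting.instB PimsnerSetting.instBK PimsnerSetting.instE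
  PimsnerSetting.instH PimsnerSetting.instH2 PimsnerSetting.instH3 PimsnerSetting.instTX

namespace PimsnerSetting

variable {G : Type} [Group G] [DecidableEq G] (S : PimsnerSetting G)

/-- The projection `1_B ⊗ e₀ ∈ B ⊗ K ⊆ E`. -/
def unitProj : S.E := S.jBK (S.stab.θ 0 0 1)

/-- The projection `1_B ⊗ e₀`, viewed in `T_X`. -/
def unitProjT : S.TX := S.ιE S.unitProj

/-- The corner `A_E = (1_B ⊗ e₀) T_X (1_B ⊗ e₀)`. -/
def corner : Set S.TX := {y : S.TX | S.unitProjT * y = y ∧ y * S.unitProjT = y}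

/-- The unital embedding `ι : B → A_E`, `b ↦ b ⊗ e₀`. -/
def cornerEmb : S.B → S.TX := fun b => S.ιE (S.jBK (S.stab.θ 0 0 b))

end PimsnerSetting

/-! The setting of Sec. 3 of the paper: a unital essential extension `K ◁ E`
of `C` by the compacts, non-degenerately represented on `H`, the Toeplitz--Pimsner
algebra `T_X` of `X = H ⊗ ℓ²(ℤ) ⊗ E`, and the shift quasi-free automorphism `Γ`
(given as a `ℤ`-action). -/
structure ToeplitzShiftSetting where
  H : Type
  [instH : NormedAddCommGroup H]
  [instH2 : InnerProductSpace ℂ H]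
  [instH3 : CompleteSpace H]
  E : Type
  [instE : CStarAlgebra E]
  sepE : TopologicalSpace.SeparableSpace E
  rep : E →⋆ₐ[ℂ] (H →L[ℂ] H)
  rep_inj : Function.Injective rep
  compacts_sub : ∀ T : H →L[ℂ] H, IsCompactOperator (⇑T) → T ∈ Set.range rep
  id_not_compact : ¬ IsCompactOperator (⇑(1 : H →L[ℂ] H))
  C : Type
  [instC : CStarAlgebra C]
  sepC : TopologicalSpace.SeparableSpace C
  nucC : IsNuclearCStar C
  quot : E →⋆ₐ[ℂ] C
  quot_surj : Function.Surjective quot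
  quot_ker : ∀ x : E, quot x = 0 ↔ IsCompactOperator (⇑(rep x))
  TX : Type
  [instTX : CStarAlgebra TX]
  ιE : E →⋆ₐ[ℂ] TX
  ιE_inj : Function.Injective ιE
  Tcr : H → ℤ → E → TX
  Tcr_addH : ∀ ζ ξ n x, Tcr (ζ + ξ) n x = Tcr ζ n x + Tcr ξ n x
  Tcr_smulH : ∀ (c : ℂ) ζ n x, Tcr (c • ζ) n x = c • Tcr ζ n x
  Tcr_addE : ∀ ζ n x y, Tcr ζ n (x + y) = Tcr ζ n x + Tcr ζ n y
  Tcr_right : ∀ ζ n x y, Tcr ζ n x * ιE y = Tcr ζ n (x * y)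
  Tcr_left : ∀ a ζ n x, ιE a * Tcr ζ n x = Tcr (rep a ζ) n x
  Tcr_star : ∀ ζ m x ξ n y,
    star (Tcr ζ m x) * Tcr ξ n y = if m = n then (inner ℂ ζ ξ : ℂ) • ιE (star x * y) else 0
  generates : closure ((NonUnitalStarAlgebra.adjoin ℂ
      {t : TX | ∃ ζ n x, t = Tcr ζ n x} : NonUnitalStarSubalgebra ℂ TX) : Set TX) = Set.univ
  vac : TX →ₗ[ℂ] E
  vac_ι : ∀ x, vac (ιE x) = x
  vac_creation : ∀ ζ n x t, vac (Tcr ζ n x * t) = 0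
  vac_annihilation : ∀ ζ n x t, vac (t * star (Tcr ζ n x)) = 0
  vac_cr : ∀ ζ n x, vac (Tcr ζ n x) = 0
  Γ : CStarAction (Multiplicative ℤ) TX
  Γ_cr : ∀ (n : ℤ) ζ m x,
    Γ.app (Multiplicative.ofAdd n) (Tcr ζ m x) = Tcr ζ (n + m) x
  Γ_ι : ∀ (n : ℤ) (x : E), Γ.app (Multiplicative.ofAdd n) (ιE x) = ιE x

attribute [instance] ToeplitzShiftSetting.instH ToeplitzShiftSetting.instH2
  ToeplitzShiftSetting.instH3 ToeplitzShiftSetting.instE ToeplitzShiftSetting.instC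
  ToeplitzShiftSetting.instTX

end

section Part1
variable {A : Type} [CStarAlgebra A]

/-- Every unital isometry has norm at most one. -/
lemma ki_iso_norm {c : A} (hc : star c * c = 1) : ‖c‖ ≤ 1 := by
  nontriviality A
  have h := CStarRing.norm_star_mul_self (x := c)
  rw [hc, norm_one] at h
  nlinarith [norm_nonneg c]

variable [PartialOrder A] [StarOrderedRing A]

lemma ki_iso_of_nonzero (hpi : ∀ a : A, a ≠ 0 → ∃ x y : A, x * a * y = 1) {f : A} (hf : f ≠ 0) :
    ∃ z : A, star (f * z) * (f * z) = 1 := by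
  obtain ⟨x, y, hxy⟩ := hpi f hf
  have h1 : star (f * y) * (star x * x) * (f * y) = 1 := by
    have : star (x * f * y) * (x * f * y) = 1 := by rw [hxy]; simp
    rw [← this]; simp only [star_mul, mul_assoc]
  have h2 : star x * x ≤ algebraMap ℝ A (‖x‖ ^ 2) := CStarAlgebra.star_mul_le_algebraMap_norm_sq
  have h3 : star (f * y) * (star x * x) * (f * y) ≤
      star (f * y) * algebraMap ℝ A (‖x‖ ^ 2) * (f * y) :=
    star_left_conjugate_le_conjugate h2 _
  have h4 : star (f * y) * algebraMap ℝ A (‖x‖ ^ 2) * (f * y) =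
      (‖x‖ ^ 2) • (star (f * y) * (f * y)) := by
    rw [Algebra.algebraMap_eq_smul_one]; simp
  rw [h1, h4] at h3
  have hu : IsUnit ((‖x‖ ^ 2) • (star (f * y) * (f * y))) := CStarAlgebra.isUnit_of_le 1 h3
  nontriviality A
  have hx : ‖x‖ ^ 2 ≠ 0 := by
    intro h0
    rw [h0, zero_smul] at hu
    exact not_isUnit_zero hu
  have hu2 : IsUnit (star (f * y) * (f * y)) := by
    have := hu.smul (Units.mk0 _ hx)⁻¹
    rw [Units.smul_def, smul_smul] at this
    simpa [hx] using this
  have hsp : IsStrictlyPositive (star (f * y) * (f * y)) := ⟨star_mul_self_nonneg _, hu2⟩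
  have h5 := CFC.conjugate_rpow_neg_one_half (star (f * y) * (f * y)) hsp
  set r := (star (f * y) * (f * y)) ^ (-(1 / 2 : ℝ)) with hr
  have hrs : star r = r := (IsSelfAdjoint.of_nonneg CFC.rpow_nonneg).star_eq
  refine ⟨y * r, ?_⟩
  rw [show f * (y * r) = f * y * r from (mul_assoc _ _ _).symm, star_mul (f * y) r, hrs]
  rw [← h5]
  simp only [mul_assoc]

lemma ki_spec_iso (hpi : ∀ a : A, a ≠ 0 → ∃ x y : A, x * a * y = 1) {a : A}
    (ha : IsSelfAdjoint a) {f : ℝ → ℝ} (hf : Continuous f) {t : ℝ} (ht : t ∈ spectrum ℝ a)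
    (hft : f t ≠ 0) : ∃ z : A, star (cfc f a * z) * (cfc f a * z) = 1 := by
  apply ki_iso_of_nonzero hpi
  intro h0
  have h1 : f t ∈ spectrum ℝ (cfc f a) := by
    rw [cfc_map_spectrum f a]; exact ⟨t, ht, rfl⟩
  rw [h0] at h1
  rcases subsingleton_or_nontrivial A with hA | hA
  · rw [spectrum.of_subsingleton] at h1
    exact h1
  rw [spectrum.zero_eq] at h1
  exact hft h1

/-- tent function -/
def kiTent (t ε x : ℝ) : ℝ := max 0 (ε - |x - t|)

lemma kiTent_cont (t ε : ℝ) : Continuous (kiTent t ε) := by unfold kiTent; fun_prop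

lemma ki_spec_near (a : A) (ha : IsSelfAdjoint a) (t : ℝ) {ε : ℝ} (hε : 0 < ε) (z : A)
    (hz : star (cfc (kiTent t ε) a * z) * (cfc (kiTent t ε) a * z) = 1) :
    ‖a * (cfc (kiTent t ε) a * z) - (t : ℂ) • (cfc (kiTent t ε) a * z)‖ ≤ ε := by
  have hct := kiTent_cont t ε
  set c := cfc (kiTent t ε) a * z with hc
  -- cut-off of x - t
  let g : ℝ → ℝ := fun x => max (-ε) (min ε (x - t))
  have hg : Continuous g := by fun_prop
  have h1 : (a - algebraMap ℝ A t) * cfc (kiTent t ε) a = cfc g a * cfc (kiTent t ε) a := by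
    have e1 : a - algebraMap ℝ A t = cfc (fun x : ℝ => x - t) a := by
      rw [cfc_sub (fun x : ℝ => x) (fun _ => t) a, cfc_id' ℝ a, cfc_const t a]
    rw [e1, ← cfc_mul (fun x : ℝ => x - t) (kiTent t ε) a, ← cfc_mul g (kiTent t ε) a]
    apply cfc_congr
    intro x _
    show (x - t) * kiTent t ε x = max (-ε) (min ε (x - t)) * kiTent t ε x
    unfold kiTent
    rcases le_total (ε - |x - t|) 0 with h | h
    · rw [max_eq_left h]; simp
    · have := abs_le.1 (show |x - t| ≤ ε by linarith)
      rw [min_eq_right this.2, max_eq_right this.1]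
  have h2 : a * c - (t : ℂ) • c = cfc g a * c := by
    rw [hc, ← mul_assoc (cfc g a), ← h1, Algebra.algebraMap_eq_smul_one]
    simp only [sub_mul, mul_assoc, smul_mul_assoc, one_mul, Complex.coe_smul]
  rw [h2]
  calc ‖cfc g a * c‖ ≤ ‖cfc g a‖ * ‖c‖ := norm_mul_le _ _
    _ ≤ ε * 1 := by
        gcongr
        · apply norm_cfc_le hε.le
          intro x _
          rw [Real.norm_eq_abs, abs_le]
          exact ⟨le_max_left _ _, max_le (by linarith) (min_le_left _ _)⟩
        · exact ki_iso_norm hz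
    _ = ε := mul_one _

lemma ki_exists_near (hpi : ∀ a : A, a ≠ 0 → ∃ x y : A, x * a * y = 1) {a : A}
    (ha : IsSelfAdjoint a) {t : ℝ} (ht : t ∈ spectrum ℝ a) {ε : ℝ} (hε : 0 < ε) :
    ∃ c : A, star c * c = 1 ∧ ‖a * c - (t : ℂ) • c‖ ≤ ε := by
  obtain ⟨z, hz⟩ := ki_spec_iso hpi ha (kiTent_cont t ε) ht (by unfold kiTent; simp; linarith)
  exact ⟨_, hz, ki_spec_near a ha t hε z hz⟩

lemma ki_exists_near_two (hpi : ∀ a : A, a ≠ 0 → ∃ x y : A, x * a * y = 1) {a : A}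
    (ha : IsSelfAdjoint a) {s t : ℝ} (hs : s ∈ spectrum ℝ a) (ht : t ∈ spectrum ℝ a)
    {ε : ℝ} (hε : 0 < ε) (hst : 2 * ε ≤ |s - t|) :
    ∃ c d : A, star c * c = 1 ∧ star d * d = 1 ∧ star c * d = 0 ∧
      ‖a * c - (s : ℂ) • c‖ ≤ ε ∧ ‖a * d - (t : ℂ) • d‖ ≤ ε := by
  obtain ⟨z, hz⟩ := ki_spec_iso hpi ha (kiTent_cont s ε) hs (by unfold kiTent; simp; linarith)
  obtain ⟨w, hw⟩ := ki_spec_iso hpi ha (kiTent_cont t ε) ht (by unfold kiTent; simp; linarith)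
  refine ⟨_, _, hz, hw, ?_, ki_spec_near a ha s hε z hz, ki_spec_near a ha t hε w hw⟩
  have hc1 := kiTent_cont s ε
  have hc2 := kiTent_cont t ε
  have h0 : cfc (kiTent s ε) a * cfc (kiTent t ε) a = 0 := by
    rw [← cfc_mul (kiTent s ε) (kiTent t ε) a]
    rw [← cfc_const_zero ℝ a]
    apply cfc_congr
    intro x _
    show kiTent s ε x * kiTent t ε x = 0
    unfold kiTent
    have := abs_sub_le s x t
    rw [abs_sub_comm s x] at this
    rcases le_total (ε - |x - s|) 0 with h | h
    · rw [max_eq_left h]; simp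
    · rw [max_eq_left (show ε - |x - t| ≤ 0 by linarith)]; simp
  have hsa : star (cfc (kiTent s ε) a) = cfc (kiTent s ε) a := (cfc_predicate (kiTent s ε) a : IsSelfAdjoint _).star_eq
  rw [star_mul, hsa, mul_assoc, ← mul_assoc (cfc (kiTent s ε) a), h0]
  simp
end Part1

section Part2
variable {A : Type} [CStarAlgebra A]

lemma ki_norm_map (α : A ≃⋆ₐ[ℂ] A) (x : A) : ‖α x‖ = ‖x‖ :=
  StarAlgEquiv.norm_map α x

/-- the lower bound hypothesis -/
def KiLow (α : A ≃⋆ₐ[ℂ] A) (b : A) : Prop :=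
  ∀ c : A, star c * c = 1 → 1 ≤ ‖star c * b * α c‖

lemma KiLow.symm {α : A ≃⋆ₐ[ℂ] A} {b : A} (h : KiLow α b) : KiLow α.symm (α.symm (star b)) := by
  intro c hc
  have := h c hc
  have e : star c * α.symm (star b) * α.symm c = α.symm (star (star c * b * α c)) := by
    simp [mul_assoc, map_star]
  rw [e, ki_norm_map, norm_star]
  exact this

lemma ki_iso_mul {c d : A} (hc : star c * c = 1) (hd : star d * d = 1) :
    star (c * d) * (c * d) = 1 := by
  rw [star_mul, mul_assoc, ← mul_assoc (star c), hc, one_mul, hd]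

lemma ki_iso_map (α : A ≃⋆ₐ[ℂ] A) {c : A} (hc : star c * c = 1) : star (α c) * α c = 1 := by
  rw [← map_star, ← map_mul, hc, map_one]

variable [PartialOrder A] [StarOrderedRing A]

lemma KiLow.one_le (hpi : ∀ a : A, a ≠ 0 → ∃ x y : A, x * a * y = 1)
    {α : A ≃⋆ₐ[ℂ] A} {b : A} (h : KiLow α b) {c : A} (hc : star c * c = 1) :
    1 ≤ (star c * b * α c) * star (star c * b * α c) := by
  set x := star c * b * α c with hx
  have hsa : IsSelfAdjoint (x * star x) := IsSelfAdjoint.mul_star_self x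
  have := algebraMap_le_of_le_spectrum (r := (1 : ℝ)) (a := x * star x) ?_ hsa
  · simpa using this
  intro t ht
  by_contra hlt
  push Not at hlt
  have ht0 : 0 ≤ t := spectrum_nonneg_of_nonneg (mul_star_self_nonneg x) ht
  obtain ⟨d, hd, hd2⟩ := ki_exists_near hpi hsa ht (ε := (1 - t) / 2) (by linarith)
  have h1 := h (c * d) (ki_iso_mul hc hd)
  have e1 : star (c * d) * b * α (c * d) = (star d * x) * α d := by
    rw [hx, star_mul, map_mul]; simp only [mul_assoc]
  rw [e1] at h1
  have hαd := ki_iso_norm (ki_iso_map α hd)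
  have hdn := ki_iso_norm hd
  have h2 : ‖star d * x * α d‖ ≤ ‖star d * x‖ := by
    calc _ ≤ ‖star d * x‖ * ‖α d‖ := norm_mul_le _ _
      _ ≤ ‖star d * x‖ * 1 := by gcongr
      _ = _ := mul_one _
  have h3 : ‖star d * x‖ * ‖star d * x‖ = ‖star d * (x * star x * d)‖ := by
    rw [← CStarRing.norm_self_mul_star]; simp [mul_assoc]
  have h4 : star d * (x * star x * d) = star d * (x * star x * d - (t : ℂ) • d) + (t : ℂ) • (1 : A) := by
    rw [mul_sub, mul_smul_comm, hd]; simp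
  have h5 : ‖star d * (x * star x * d)‖ ≤ (1 - t) / 2 + t := by
    rw [h4]
    refine (norm_add_le _ _).trans ?_
    gcongr
    · calc _ ≤ ‖star d‖ * ‖x * star x * d - (t : ℂ) • d‖ := norm_mul_le _ _
        _ ≤ 1 * ((1 - t) / 2) := by
          rw [norm_star]; gcongr
        _ = _ := one_mul _
    · rw [norm_smul, Complex.norm_real, Real.norm_of_nonneg ht0]
      have : ‖(1 : A)‖ ≤ 1 := ki_iso_norm (by simp)
      nlinarith
  nlinarith [norm_nonneg (star d * x)]

lemma KiLow.off (hpi : ∀ a : A, a ≠ 0 → ∃ x y : A, x * a * y = 1)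
    {α : A ≃⋆ₐ[ℂ] A} {b : A} (h : KiLow α b) {η : ℝ} (hη : 0 ≤ η) (hb : ‖b‖ ^ 2 ≤ 1 + η)
    {c : A} (hc : star c * c = 1) :
    ‖star c * b * α (1 - c * star c)‖ ^ 2 ≤ η := by
  have h1 := h.one_le hpi hc
  set y := star c * b * α (1 - c * star c) with hy
  have hp : (1 - c * star c) * (1 - c * star c) = 1 - c * star c := by
    have : c * star c * (c * star c) = c * star c := by
      rw [mul_assoc, ← mul_assoc (star c), hc, one_mul]
    simp [mul_sub, sub_mul, this]
  have e : y * star y + (star c * b * α c) * star (star c * b * α c)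
      = (star c * b) * star (star c * b) := by
    have e1 : y * star y = star c * b * α (1 - c * star c) * star b * c := by
      have : star (α (1 - c * star c)) = α (1 - c * star c) := by
        rw [← map_star]; simp
      rw [hy, star_mul, this, star_mul, star_star]
      calc _ = star c * b * (α (1 - c * star c) * α (1 - c * star c)) * star b * c := by
            simp only [mul_assoc]
        _ = _ := by rw [← map_mul, hp]
    rw [e1]
    simp only [star_mul, star_star, map_sub, map_one, map_mul, map_star, mul_sub, sub_mul, mul_one, mul_assoc]
    abel
  have h2 : (star c * b) * star (star c * b) ≤ algebraMap ℝ A (‖b‖ ^ 2) := by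
    refine (CStarAlgebra.mul_star_le_algebraMap_norm_sq).trans ?_
    apply algebraMap_mono
    gcongr
    calc _ ≤ ‖star c‖ * ‖b‖ := norm_mul_le _ _
      _ ≤ 1 * ‖b‖ := by
        rw [norm_star]; gcongr; exact ki_iso_norm hc
      _ = _ := one_mul _
  have h3 : (algebraMap ℝ A (‖b‖ ^ 2)) ≤ algebraMap ℝ A (1 + η) := algebraMap_mono _ hb
  have h4 : y * star y ≤ algebraMap ℝ A η := by
    have := h2.trans h3
    rw [← e, map_add, map_one, add_comm 1] at this
    have h5 := add_le_add_right h1 (y * star y)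
    exact le_of_add_le_add_right (h5.trans this)
  have h6 := (CStarAlgebra.norm_le_iff_le_algebraMap (y * star y) hη (mul_star_self_nonneg y)).2 h4
  rw [CStarRing.norm_self_mul_star] at h6
  rw [sq]; exact h6

lemma KiLow.proj (hpi : ∀ a : A, a ≠ 0 → ∃ x y : A, x * a * y = 1)
    {α : A ≃⋆ₐ[ℂ] A} {b : A} (h : KiLow α b) {κ : ℝ} (hκ : 0 ≤ κ) (hb : ‖b‖ ^ 2 ≤ 1 + κ ^ 2)
    {c : A} (hc : star c * c = 1) :
    ‖c * star c * b - b * α (c * star c)‖ ≤ 2 * κ := by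
  have h1 := h.off hpi (sq_nonneg κ) hb hc
  have h2 := h.symm.off hpi (sq_nonneg κ) (by rw [ki_norm_map, norm_star]; exact hb) hc
  have e2 : star c * α.symm (star b) * α.symm (1 - c * star c)
      = α.symm (star ((1 - c * star c) * b * α c)) := by
    simp [mul_assoc, map_star]
  rw [e2, ki_norm_map, norm_star] at h2
  have h1' := abs_le_of_sq_le_sq h1 hκ
  have h2' := abs_le_of_sq_le_sq h2 hκ
  have hcn := ki_iso_norm hc
  have hαc := ki_iso_norm (ki_iso_map α hc)
  have e : c * star c * b - b * α (c * star c)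
     = c * (star c * b * α (1 - c * star c)) - ((1 - c * star c) * b * α c) * star (α c) := by
    simp only [map_sub, map_one, map_mul, map_star, mul_sub, sub_mul, mul_one, one_mul, mul_assoc]
    abel
  rw [e]
  refine (norm_sub_le _ _).trans ?_
  have a1 := norm_mul_le c (star c * b * α (1 - c * star c))
  have a2 := norm_mul_le ((1 - c * star c) * b * α c) (star (α c))
  rw [norm_star] at a2
  have n1 := norm_nonneg (star c * b * α (1 - c * star c))
  have n2 := norm_nonneg ((1 - c * star c) * b * α c)
  nlinarith [(abs_le.1 h1').2, (abs_le.1 h2').2, norm_nonneg c, norm_nonneg (α c)]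

lemma KiLow.unitary (hpi : ∀ a : A, a ≠ 0 → ∃ x y : A, x * a * y = 1)
    {α : A ≃⋆ₐ[ℂ] A} {b : A} (h : KiLow α b) {κ : ℝ} (hκ : 0 ≤ κ) (hb : ‖b‖ ^ 2 ≤ 1 + κ ^ 2)
    {s t : A} (hs : star s * s = 1) (ht : star t * t = 1) (hst : star s * t = 0)
    {y : A} (hy : y ∈ unitary A) :
    ‖y * (star t * b * α t) - (star s * b * α s) * α y‖ ≤ 8 * κ := by
  have hts : star t * s = 0 := by simpa using congrArg star hst
  have hyy : star y * y = 1 := (Unitary.mem_iff.1 hy).1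
  -- the two isometries
  have iso : ∀ σ : ℂ, σ * σ = 1 → star σ = σ →
      star (((Real.sqrt 2)⁻¹ : ℂ) • (σ • (s * y) + t)) * (((Real.sqrt 2)⁻¹ : ℂ) • (σ • (s * y) + t)) = 1 := by
    intro σ hσ hσ'
    have r2 : ((Real.sqrt 2)⁻¹ : ℂ) * ((Real.sqrt 2)⁻¹ : ℂ) = 1 / 2 := by
      rw [← mul_inv, ← Complex.ofReal_mul, Real.mul_self_sqrt (by norm_num)]; norm_num
    have hstar : star ((Real.sqrt 2)⁻¹ : ℂ) = ((Real.sqrt 2)⁻¹ : ℂ) := by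
      rw [← Complex.ofReal_inv]; simp
    have q1 : star y * (star s * (s * y)) = 1 := by rw [← mul_assoc (star s), hs, one_mul, hyy]
    have q2 : star y * (star s * t) = 0 := by rw [hst, mul_zero]
    have q3 : star t * (s * y) = 0 := by rw [← mul_assoc, hts, zero_mul]
    rw [star_smul, hstar, smul_mul_smul_comm, r2, star_add, star_smul, hσ', star_mul]
    simp only [mul_add, add_mul, smul_mul_assoc, mul_smul_comm, smul_smul, mul_assoc, q1, q2, q3, ht, hσ]
    simp only [smul_zero, add_zero, zero_add, one_smul, smul_smul, hσ]
    module
  have P : ∀ σ : ℂ, σ * σ = 1 → star σ = σ →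
      (((Real.sqrt 2)⁻¹ : ℂ) • (σ • (s * y) + t)) * star (((Real.sqrt 2)⁻¹ : ℂ) • (σ • (s * y) + t))
       = (1 / 2 : ℂ) • (s * (y * star y) * star s + t * star t + σ • (s * y * star t + t * (star y * star s))) := by
    intro σ hσ hσ'
    have r2 : ((Real.sqrt 2)⁻¹ : ℂ) * ((Real.sqrt 2)⁻¹ : ℂ) = 1 / 2 := by
      rw [← mul_inv, ← Complex.ofReal_mul, Real.mul_self_sqrt (by norm_num)]; norm_num
    have hstar : star ((Real.sqrt 2)⁻¹ : ℂ) = ((Real.sqrt 2)⁻¹ : ℂ) := by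
      rw [← Complex.ofReal_inv]; simp
    rw [star_smul, hstar, smul_mul_smul_comm, r2, star_add, star_smul, hσ', star_mul]
    simp only [mul_add, add_mul, smul_mul_assoc, mul_smul_comm, smul_smul, mul_assoc, hσ, one_smul, smul_add]
    abel
  have b1 := h.proj hpi hκ hb (iso 1 (by simp) (by simp))
  have b2 := h.proj hpi hκ hb (iso (-1) (by simp) (by simp))
  have b3 := h.proj hpi hκ hb hs
  have b4 := h.proj hpi hκ hb ht
  rw [P 1 (by simp) (by simp)] at b1
  rw [P (-1) (by simp) (by simp)] at b2
  set X := s * y * star t + t * (star y * star s) with hX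
  have bX : ‖X * b - b * α X‖ ≤ 4 * κ := by
    set E := s * (y * star y) * star s + t * star t with hE
    have e : X * b - b * α X = ((1 / 2 : ℂ) • (E + (1 : ℂ) • X) * b - b * α ((1 / 2 : ℂ) • (E + (1 : ℂ) • X)))
       - ((1 / 2 : ℂ) • (E + (-1 : ℂ) • X) * b - b * α ((1 / 2 : ℂ) • (E + (-1 : ℂ) • X))) := by
      simp only [map_smul, map_add, smul_mul_assoc, mul_smul_comm, add_mul, mul_add]
      module
    rw [e]
    exact (norm_sub_le _ _).trans (by linarith)
  have hsn := ki_iso_norm hs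
  have htn := ki_iso_norm ht
  have hαt := ki_iso_norm (ki_iso_map α ht)
  have hXe : star s * X * t = y := by
    rw [hX]
    simp only [mul_add, add_mul, mul_assoc]
    rw [ht, mul_one, ← mul_assoc (star s) s, hs, one_mul, ← mul_assoc (star s) t, hst]
    simp
  have key : y * (star t * b * α t) - (star s * b * α s) * α y
      = star s * (X * (t * star t * b - b * α (t * star t))) * α t
        + star s * (X * b - b * α X) * α t
        + star s * (s * star s * b - b * α (s * star s)) * α (X * t) := by
    have hsX : star (α s) * (α X * α t) = α y := by
      rw [← map_star, ← map_mul, ← map_mul, ← mul_assoc, hXe]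
    have htt : star (α t) * α t = 1 := ki_iso_map α ht
    have hss : ∀ z : A, star s * (s * z) = z := fun z => by rw [← mul_assoc, hs, one_mul]
    conv_lhs => rw [← hXe]
    rw [hXe]
    simp only [map_mul, map_star, mul_sub, sub_mul, mul_assoc, hss, hsX, htt, mul_one]
    have hXe' : star s * (X * (t * (star t * (b * α t)))) = y * (star t * (b * α t)) := by
      rw [← hXe]; simp only [mul_assoc]
    rw [hXe']
    abel
  rw [key]
  have hyn : ‖y‖ ≤ 1 := ki_iso_norm hyy
  have hXn : ‖star s * X‖ ≤ 1 := by
    have : star s * X = y * star t := by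
      rw [hX]
      simp only [mul_add, mul_assoc]
      rw [← mul_assoc (star s) s, hs, one_mul, ← mul_assoc (star s) t, hst]
      simp
    rw [this]
    refine (norm_mul_le _ _).trans ?_
    rw [norm_star]
    exact mul_le_one₀ hyn (norm_nonneg _) htn
  have hXt : ‖α (X * t)‖ ≤ 1 := by
    rw [ki_norm_map]
    have : X * t = s * y := by
      rw [hX]
      simp only [add_mul, mul_assoc]
      rw [ht, hst]
      simp
    rw [this]
    exact (norm_mul_le _ _).trans (mul_le_one₀ hsn (norm_nonneg _) hyn)
  have tri : ∀ p q r : A, ∀ k : ℝ, ‖p‖ ≤ 1 → ‖r‖ ≤ 1 → ‖q‖ ≤ k → ‖p * q * r‖ ≤ k := by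
    intro p q r k hp hr hq
    have n1 := norm_mul_le (p * q) r
    have n2 := norm_mul_le p q
    have n3 := norm_nonneg q
    have n4 := norm_nonneg (p * q)
    have n5 : ‖p * q‖ ≤ ‖q‖ := n2.trans (by nlinarith)
    have n6 : ‖p * q‖ * ‖r‖ ≤ ‖p * q‖ := by nlinarith
    linarith
  have c1 : ‖star s * (X * (t * star t * b - b * α (t * star t))) * α t‖ ≤ 2 * κ := by
    rw [← mul_assoc (star s) X]
    exact tri _ _ _ _ hXn hαt b4
  have c2 : ‖star s * (X * b - b * α X) * α t‖ ≤ 4 * κ :=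
    tri _ _ _ _ (by rw [norm_star]; exact hsn) hαt bX
  have c3 : ‖star s * (s * star s * b - b * α (s * star s)) * α (X * t)‖ ≤ 2 * κ :=
    tri _ _ _ _ (by rw [norm_star]; exact hsn) hXt b3
  refine (norm_add_le _ _).trans ?_
  have := norm_add_le (star s * (X * (t * star t * b - b * α (t * star t))) * α t) (star s * (X * b - b * α X) * α t)
  linarith
end Part2

section Part3
variable {A : Type} [CStarAlgebra A]

lemma ki_four (D : A →ₗ[ℂ] A) {ε : ℝ} (hD : ∀ y ∈ unitary A, ‖D y‖ ≤ ε) (x : A) :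
    ‖D x‖ ≤ 2 * ε * ‖x‖ := by
  obtain ⟨u, c, hx, hc⟩ := CStarAlgebra.exists_sum_four_unitary x
  have h0 : 0 ≤ ε := (norm_nonneg _).trans (hD 1 (one_mem _))
  have : D x = ∑ i, c i • D (u i) := by
    conv_lhs => rw [hx]
    simp [map_sum]
  rw [this]
  calc _ ≤ ∑ i, ‖c i • D (u i)‖ := norm_sum_le _ _
    _ ≤ ∑ i : Fin 4, ‖x‖ / 2 * ε := by
      apply Finset.sum_le_sum
      intro i _
      rw [norm_smul]
      exact mul_le_mul (hc i) (hD _ (u i).2) (norm_nonneg _) (by positivity)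
    _ = _ := by simp; ring

lemma ki_four_comm (v : A) {ε : ℝ} (hv : ∀ y ∈ unitary A, ‖y * v - v * y‖ ≤ ε) (x : A) :
    ‖x * v - v * x‖ ≤ 2 * ε * ‖x‖ := by
  have := ki_four (LinearMap.mulRight ℂ v - LinearMap.mulLeft ℂ v) (ε := ε)
    (by intro y hy; simpa using hv y hy) x
  simpa using this

lemma ki_four_zero (α : A ≃⋆ₐ[ℂ] A) (z : A) (hz : ∀ y ∈ unitary A, y * z = z * α y) (x : A) :
    x * z = z * α x := by
  have := ki_four (LinearMap.mulRight ℂ z -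
    (LinearMap.mulLeft ℂ z).comp (α : A →ₗ[ℂ] A)) (ε := 0)
    (by intro y hy; simp [hz y hy]) x
  simp only [mul_zero, zero_mul, norm_le_zero_iff] at this
  simpa [sub_eq_zero] using this

/-- abstract limiting lemma -/
lemma ki_limit {E : Type} [NormedAddCommGroup E] [NormedSpace ℂ E] [CompleteSpace E]
    (u : ℕ → E) (e : ℕ → ℝ) (he : Filter.Tendsto e Filter.atTop (nhds 0))
    (he4 : ∀ n, e n ≤ 1 / 4) (h1 : ∀ n, 1 ≤ ‖u n‖) (h2 : ∀ n, ‖u n‖ ≤ 2)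
    (h : ∀ n m, ∃ l : ℂ, ‖u n - l • u m‖ ≤ e n + e m) :
    ∃ (k : ℕ → ℂ) (z : E), z ≠ 0 ∧ (∀ n, ‖k n‖ ≤ 5) ∧
      Filter.Tendsto (fun n => k n • u n) Filter.atTop (nhds z) := by
  obtain ⟨f, hf1, hf2⟩ := exists_dual_vector ℂ (u 0) (by have := h1 0; positivity)
  have fb : ∀ x, ‖f x‖ ≤ ‖x‖ := fun x => by simpa [hf1] using f.le_opNorm x
  have low : ∀ n, 1 / 5 ≤ ‖f (u n)‖ := by
    intro n
    obtain ⟨l, hl⟩ := h 0 n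
    have a1 : ‖u 0 - l • u n‖ ≤ 1 / 2 := hl.trans (by linarith [he4 0, he4 n])
    have a2 : ‖l • u n‖ ≤ 5 / 2 := by
      have := norm_sub_norm_le (l • u n) (u 0)
      rw [norm_sub_rev] at this
      linarith [h2 0]
    rw [norm_smul] at a2
    have a3 : ‖l‖ ≤ 5 / 2 := by nlinarith [h1 n, norm_nonneg l]
    have a4 := (fb _).trans a1
    rw [map_sub, map_smul, smul_eq_mul] at a4
    have a5 := norm_sub_norm_le (f (u 0)) (l * f (u n))
    have a6 : 1 ≤ ‖f (u 0)‖ := by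
      rw [hf2]; simpa using h1 0
    rw [norm_mul] at a5
    nlinarith [norm_nonneg (f (u n))]
  have ne : ∀ n, f (u n) ≠ 0 := fun n h0 => by
    have := low n; rw [h0] at this; norm_num at this
  have kb : ∀ n, ‖(f (u n))⁻¹‖ ≤ 5 := by
    intro n
    rw [norm_inv]
    rw [inv_le_comm₀ (by linarith [low n]) (by norm_num)]
    linarith [low n]
  set zz : ℕ → E := fun n => (f (u n))⁻¹ • u n with hzz
  have diff : ∀ n m, ‖zz n - zz m‖ ≤ 55 * (e n + e m) := by
    intro n m
    obtain ⟨l, hl⟩ := h n m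
    set r := u n - l • u m with hr
    have hl' : l = (f (u n) - f r) * (f (u m))⁻¹ := by
      rw [hr, map_sub, map_smul, smul_eq_mul]
      field_simp [ne m]
      ring
    clear_value r
    have e1 : zz n - zz m = (f (u n))⁻¹ • (r - f r • zz m) := by
      have this : (f (u n))⁻¹ • u n = (f (u n))⁻¹ • r + ((f (u n))⁻¹ * l) • u m := by
        rw [hr, smul_sub, smul_smul]; abel
      have e2 : (f (u n))⁻¹ * l
          = (f (u m))⁻¹ - (f (u n))⁻¹ * (f r * (f (u m))⁻¹) := by
        rw [hl']
        field_simp [ne n, ne m]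
      show (f (u n))⁻¹ • u n - (f (u m))⁻¹ • u m = (f (u n))⁻¹ • (r - f r • (f (u m))⁻¹ • u m)
      rw [this, e2, sub_smul, smul_sub, smul_smul, smul_smul]
      simp only [mul_assoc]
      abel
    rw [e1, norm_smul]
    have b1 : ‖zz m‖ ≤ 10 := by
      simp only [hzz]; rw [norm_smul]
      nlinarith [kb m, h2 m, norm_nonneg (f (u m))⁻¹, norm_nonneg (u m)]
    have b2 : ‖r - f r • zz m‖ ≤ 11 * (e n + e m) := by
      refine (norm_sub_le _ _).trans ?_
      rw [norm_smul]
      have := fb r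
      nlinarith [norm_nonneg (f r), norm_nonneg r, norm_nonneg (zz m)]
    nlinarith [kb n, norm_nonneg (f (u n))⁻¹, norm_nonneg (r - f r • zz m)]
  have hc : CauchySeq zz := by
    rw [Metric.cauchySeq_iff]
    intro δ hδ
    have := he.eventually (gt_mem_nhds (show 0 < δ / 110 by positivity))
    obtain ⟨N, hN⟩ := Filter.eventually_atTop.1 this
    refine ⟨N, fun m hm n hn => ?_⟩
    rw [dist_eq_norm]
    have := diff m n
    linarith [hN m hm, hN n hn]
  obtain ⟨z, hz⟩ := cauchySeq_tendsto_of_complete hc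
  refine ⟨fun n => (f (u n))⁻¹, z, ?_, kb, hz⟩
  rintro rfl
  have h3 : Filter.Tendsto (fun n => f (zz n)) Filter.atTop (nhds (f 0)) :=
    (f.continuous.tendsto _).comp hz
  have h4 : (fun n => f (zz n)) = fun _ => (1 : ℂ) := by
    funext n
    simp [hzz, ne n]
  rw [h4, map_zero] at h3
  exact one_ne_zero (tendsto_nhds_unique tendsto_const_nhds h3)

variable [PartialOrder A] [StarOrderedRing A]

lemma ki_G_sa [Nontrivial A] (hpi : ∀ a : A, a ≠ 0 → ∃ x y : A, x * a * y = 1) {a : A}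
    (ha : IsSelfAdjoint a) {K : ℝ} (h : ∀ x : A, ‖x‖ ≤ 1 → ‖x * a - a * x‖ ≤ K) :
    ∃ t ∈ spectrum ℝ a, ‖a - (t : ℂ) • (1 : A)‖ ≤ K := by
  obtain ⟨t, ht⟩ := ContinuousFunctionalCalculus.spectrum_nonempty (R := ℝ) a ha
  refine ⟨t, ht, ?_⟩
  apply le_of_forall_pos_le_add
  intro δ hδ
  obtain ⟨c, hc, hcd⟩ := ki_exists_near hpi ha ht hδ
  have hcn := ki_iso_norm hc
  have hsn : ‖star c‖ ≤ 1 := by rwa [norm_star]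
  have e : a - (t : ℂ) • (1 : A) = star c * (a * c - (t : ℂ) • c) - (star c * a - a * star c) * c := by
    simp only [mul_sub, sub_mul, mul_smul_comm, mul_assoc, hc, mul_one]
    abel
  rw [e]
  refine (norm_sub_le _ _).trans ?_
  have n1 := norm_mul_le (star c) (a * c - (t : ℂ) • c)
  have n2 := norm_mul_le (star c * a - a * star c) c
  have := h (star c) hsn
  nlinarith [norm_nonneg (a * c - (t : ℂ) • c), norm_nonneg (star c * a - a * star c)]

lemma ki_G [Nontrivial A] (hpi : ∀ a : A, a ≠ 0 → ∃ x y : A, x * a * y = 1) {v : A}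
    {ε : ℝ} (hv : ∀ y ∈ unitary A, ‖y * v - v * y‖ ≤ ε) :
    ∃ l : ℂ, ‖v - l • (1 : A)‖ ≤ 4 * ε := by
  have h0 : 0 ≤ ε := (norm_nonneg _).trans (hv 1 (one_mem _))
  have h1 : ∀ x : A, ‖x‖ ≤ 1 → ‖x * v - v * x‖ ≤ 2 * ε := fun x hx =>
    (ki_four_comm v hv x).trans (by nlinarith [norm_nonneg x])
  have h2 : ∀ x : A, ‖x‖ ≤ 1 → ‖x * star v - star v * x‖ ≤ 2 * ε := fun x hx => by
    have := h1 (star x) (by rwa [norm_star])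
    rw [← norm_star] at this
    simp only [star_sub, star_mul, star_star] at this
    rwa [norm_sub_rev]
  obtain ⟨t, -, ht⟩ := ki_G_sa hpi (realPart v).2 (K := 2 * ε) (by
    intro x hx
    have e : x * (realPart v : A) - (realPart v : A) * x
        = (2⁻¹ : ℝ) • ((x * v - v * x) + (x * star v - star v * x)) := by
      rw [realPart_apply_coe]
      simp only [mul_smul_comm, smul_mul_assoc, mul_add, add_mul, ← smul_sub]
      congr 1; abel
    rw [e, norm_smul, Real.norm_of_nonneg (by norm_num)]
    have := norm_add_le (x * v - v * x) (x * star v - star v * x)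
    linarith [h1 x hx, h2 x hx])
  obtain ⟨s, -, hs⟩ := ki_G_sa hpi (imaginaryPart v).2 (K := 2 * ε) (by
    intro x hx
    have e : x * (imaginaryPart v : A) - (imaginaryPart v : A) * x
        = (-Complex.I) • (2⁻¹ : ℝ) • ((x * v - v * x) - (x * star v - star v * x)) := by
      rw [imaginaryPart_apply_coe]
      simp only [mul_smul_comm, smul_mul_assoc, mul_sub, sub_mul, ← smul_sub]
      congr 2; abel
    rw [e, norm_smul, norm_smul, Real.norm_of_nonneg (by norm_num)]
    have := norm_sub_le (x * v - v * x) (x * star v - star v * x)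
    simp only [norm_neg, Complex.norm_I]
    linarith [h1 x hx, h2 x hx])
  refine ⟨t + Complex.I * s, ?_⟩
  have e : v - ((t : ℂ) + Complex.I * s) • (1 : A)
     = ((realPart v : A) - (t : ℂ) • (1 : A)) + Complex.I • ((imaginaryPart v : A) - (s : ℂ) • (1 : A)) := by
    conv_lhs => rw [← realPart_add_I_smul_imaginaryPart v]
    rw [add_smul, smul_sub, smul_smul]; abel
  rw [e]
  refine (norm_add_le _ _).trans ?_
  rw [norm_smul, Complex.norm_I]
  linarith

lemma ki_pair [Nontrivial A] (hpi : ∀ a : A, a ≠ 0 → ∃ x y : A, x * a * y = 1)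
    (α : A ≃⋆ₐ[ℂ] A) {u w : A} {e f : ℝ} (hu : ‖u‖ ≤ 2) (hw : ‖w‖ ≤ 2)
    (h1 : ∀ y ∈ unitary A, ‖y * u - u * α y‖ ≤ e)
    (h2 : ∀ y ∈ unitary A, ‖y * w - w * α y‖ ≤ f) (h3 : ‖star w * w - 1‖ ≤ f) :
    ∃ l : ℂ, ‖u - l • w‖ ≤ 20 * (e + f) := by
  have he : 0 ≤ e := (norm_nonneg _).trans (h1 1 (one_mem _))
  have hf : 0 ≤ f := (norm_nonneg _).trans h3
  obtain ⟨l, hl⟩ := ki_G hpi (v := u * star w) (ε := 2 * (e + f)) (by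
    intro y hy
    have a1 := h1 y hy
    have a2 := h2 (star y) (Unitary.star_mem hy)
    have e1 : y * (u * star w) - u * star w * y
        = (y * u - u * α y) * star w - u * star (star y * w - w * α (star y)) := by
      simp only [star_sub, star_mul, star_star, map_star, mul_sub, sub_mul, mul_assoc]
      abel
    rw [e1]
    refine (norm_sub_le _ _).trans ?_
    have n1 := norm_mul_le (y * u - u * α y) (star w)
    have n2 := norm_mul_le u (star (star y * w - w * α (star y)))
    rw [norm_star] at n1 n2
    nlinarith [norm_nonneg u, norm_nonneg w, norm_nonneg (y * u - u * α y),
      norm_nonneg (star y * w - w * α (star y))])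
  refine ⟨l, ?_⟩
  have e1 : u - l • w = (u * star w - l • (1 : A)) * w - u * (star w * w - 1) := by
    simp only [mul_sub, sub_mul, mul_assoc, smul_mul_assoc, one_mul, mul_one]
    abel
  rw [e1]
  refine (norm_sub_le _ _).trans ?_
  have n1 := norm_mul_le (u * star w - l • (1 : A)) w
  have n2 := norm_mul_le u (star w * w - 1)
  nlinarith [norm_nonneg u, norm_nonneg w, norm_nonneg (u * star w - l • (1 : A)),
    norm_nonneg (star w * w - 1)]

lemma ki_inner [Nontrivial A] (hpi : ∀ a : A, a ≠ 0 → ∃ x y : A, x * a * y = 1)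
    (α : A ≃⋆ₐ[ℂ] A) {z : A} (hz : z ≠ 0) (h : ∀ y : A, y * z = z * α y) : IsInnerAut α := by
  have h' : ∀ y : A, α y * star z = star z * y := by
    intro y
    have := congrArg star (h (star y))
    simp only [star_mul, star_star, map_star] at this
    exact this.symm
  have n2 : 0 < ‖z‖ * ‖z‖ := mul_pos (norm_pos_iff.2 hz) (norm_pos_iff.2 hz)
  have sc : ∀ a : A, 0 ≤ a → ‖a‖ = ‖z‖ * ‖z‖ → (∀ x, x * a = a * x) →
      a = ((‖z‖ * ‖z‖ : ℝ) : ℂ) • (1 : A) := by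
    intro a ha hn hc
    obtain ⟨t, ht, hta⟩ := ki_G_sa hpi (IsSelfAdjoint.of_nonneg ha) (K := 0) (by
      intro x _; rw [hc x]; simp)
    have hta' : a = (t : ℂ) • (1 : A) := by
      rwa [norm_le_zero_iff, sub_eq_zero] at hta
    have ht0 : 0 ≤ t := spectrum_nonneg_of_nonneg ha ht
    have : ‖a‖ = t := by
      rw [hta', norm_smul, norm_one, mul_one, Complex.norm_real, Real.norm_of_nonneg ht0]
    rw [← hn, this]; exact hta'
  have z1 : z * star z = ((‖z‖ * ‖z‖ : ℝ) : ℂ) • (1 : A) := by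
    apply sc _ (mul_star_self_nonneg z) CStarRing.norm_self_mul_star
    intro x
    rw [← mul_assoc, h, mul_assoc, h', mul_assoc]
  have z2 : star z * z = ((‖z‖ * ‖z‖ : ℝ) : ℂ) • (1 : A) := by
    apply sc _ (star_mul_self_nonneg z) CStarRing.norm_star_mul_self
    intro x
    obtain ⟨y, hy⟩ := α.surjective x
    have hy' : α y = x := hy
    rw [← hy']
    rw [← mul_assoc, h', mul_assoc, h, mul_assoc]
  have hk : ((‖z‖⁻¹ : ℝ) : ℂ) * ((‖z‖⁻¹ : ℝ) : ℂ) * ((‖z‖ * ‖z‖ : ℝ) : ℂ) = 1 := by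
    rw [← Complex.ofReal_mul, ← Complex.ofReal_mul]
    have : ‖z‖ ≠ 0 := norm_ne_zero_iff.2 hz
    norm_cast
    field_simp
  have hks : star ((‖z‖⁻¹ : ℝ) : ℂ) = ((‖z‖⁻¹ : ℝ) : ℂ) := by simp
  set k := ((‖z‖⁻¹ : ℝ) : ℂ) with hkdef
  refine ⟨k • star z, ?_, ?_⟩
  · rw [Unitary.mem_iff]
    constructor
    · rw [star_smul, hks, star_star, smul_mul_smul_comm, z1, smul_smul, hk, one_smul]
    · rw [star_smul, hks, star_star, smul_mul_smul_comm, z2, smul_smul, hk, one_smul]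
  · intro a
    rw [star_smul, hks, star_star, smul_mul_assoc, ← h', smul_mul_smul_comm, mul_assoc, z2, mul_smul_comm,
      smul_smul, hk, one_smul, mul_one]

lemma ki_sub_one {x : A} {η : ℝ} (hη : 0 ≤ η) (h : 1 ≤ x * star x) (hx : ‖x‖ ^ 2 ≤ 1 + η) :
    ‖x * star x - 1‖ ≤ η := by
  rw [CStarAlgebra.norm_le_iff_le_algebraMap _ hη (sub_nonneg.2 h)]
  have h2 : x * star x ≤ algebraMap ℝ A (‖x‖ ^ 2) := CStarAlgebra.mul_star_le_algebraMap_norm_sq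
  have h3 : (algebraMap ℝ A (‖x‖ ^ 2)) ≤ algebraMap ℝ A (1 + η) := algebraMap_mono _ hx
  have := h2.trans h3
  rw [map_add, map_one] at this
  exact sub_le_iff_le_add'.2 this

lemma ki_low_u (hpi : ∀ a : A, a ≠ 0 → ∃ x y : A, x * a * y = 1)
    {α : A ≃⋆ₐ[ℂ] A} {b : A} (h : KiLow α b) {κ : ℝ} (hκ : 0 ≤ κ) (hκ1 : κ ≤ 1)
    (hb : ‖b‖ ^ 2 ≤ 1 + κ ^ 2)
    {s t : A} (hs : star s * s = 1) (ht : star t * t = 1) (hst : star s * t = 0) :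
    ∃ u : A, 1 ≤ ‖u‖ ∧ ‖u‖ ≤ 2 ∧ ‖star u * u - 1‖ ≤ 16 * κ ∧
      ∀ y ∈ unitary A, ‖y * u - u * α y‖ ≤ 16 * κ := by
  set u := star s * b * α s with hu
  have nb : ‖u‖ ≤ ‖b‖ := by
    have n1 := norm_mul_le (star s * b) (α s)
    have n2 := norm_mul_le (star s) b
    rw [norm_star] at n2
    have n3 := ki_iso_norm hs
    have n4 := ki_iso_norm (ki_iso_map α hs)
    have n5 := norm_nonneg b
    have n6 := norm_nonneg (star s * b)
    have n7 : ‖star s * b‖ ≤ ‖b‖ := n2.trans (by nlinarith)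
    exact n1.trans (by nlinarith)
  have nu2 : ‖u‖ ^ 2 ≤ 1 + κ ^ 2 := le_trans (by gcongr) hb
  refine ⟨u, h s hs, ?_, ?_, ?_⟩
  · nlinarith [norm_nonneg u]
  · have h1 := h.symm.one_le hpi hs
    have e2 : star s * α.symm (star b) * α.symm s = α.symm (star u) := by
      simp [hu, mul_assoc, map_star]
    rw [e2] at h1
    have h2 := ki_sub_one (sq_nonneg κ) h1 (by rw [ki_norm_map, norm_star]; exact nu2)
    have e3 : α.symm (star u) * star (α.symm (star u)) - 1 = α.symm (star u * u - 1) := by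
      simp [map_star]
    rw [e3, ki_norm_map] at h2
    nlinarith
  · intro y hy
    have h1 := h.unitary hpi hκ hb hs ht hst hy
    have h2 := h.unitary hpi hκ hb hs ht hst (one_mem (unitary A))
    rw [map_one, mul_one, one_mul] at h2
    have hyn : ‖y‖ ≤ 1 := ki_iso_norm (Unitary.mem_iff.1 hy).1
    have e : y * u - u * α y = (y * (star t * b * α t) - (star s * b * α s) * α y)
      - y * (star t * b * α t - star s * b * α s) := by
      rw [hu]; simp only [mul_sub]; abel
    rw [e]
    refine (norm_sub_le _ _).trans ?_
    have := norm_mul_le y (star t * b * α t - star s * b * α s)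
    nlinarith [norm_nonneg y, norm_nonneg (star t * b * α t - star s * b * α s)]

lemma ki_K1 [Nontrivial A] (hpi : ∀ a : A, a ≠ 0 → ∃ x y : A, x * a * y = 1)
    {s t : A} (hs : star s * s = 1) (ht : star t * t = 1) (hst : star s * t = 0)
    (α : A ≃⋆ₐ[ℂ] A) (hα : ¬ IsInnerAut α) (b : A) {ε : ℝ} (hε : 0 < ε) :
    ∃ c : A, star c * c = 1 ∧ ‖star c * b * α c‖ < ε := by
  by_contra hcon
  push Not at hcon
  apply hα
  set S : Set ℝ := {r | ∃ c : A, star c * c = 1 ∧ r = ‖star c * b * α c‖} with hS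
  have hSne : S.Nonempty := ⟨_, s, hs, rfl⟩
  have hSb : BddBelow S := ⟨ε, by rintro r ⟨c, hc, rfl⟩; exact hcon c hc⟩
  set γ := sInf S with hγ
  have hγ0 : 0 < γ := lt_of_lt_of_le hε (le_csInf hSne (by rintro r ⟨c, hc, rfl⟩; exact hcon c hc))
  have hγle : ∀ c : A, star c * c = 1 → γ ≤ ‖star c * b * α c‖ := fun c hc =>
    csInf_le hSb ⟨c, hc, rfl⟩
  have main : ∀ n : ℕ, ∃ u : A, 1 ≤ ‖u‖ ∧ ‖u‖ ≤ 2 ∧ ‖star u * u - 1‖ ≤ (80 * ((n : ℝ) + 1))⁻¹ ∧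
      ∀ y ∈ unitary A, ‖y * u - u * α y‖ ≤ (80 * ((n : ℝ) + 1))⁻¹ := by
    intro n
    set κ : ℝ := (80 * ((n : ℝ) + 1))⁻¹ / 16 with hκ
    have hκ0 : 0 < κ := by positivity
    have hκ1 : κ ≤ 1 := by
      rw [hκ]
      have : (80 * ((n : ℝ) + 1))⁻¹ ≤ 1 := by
        apply inv_le_one_of_one_le₀
        have : (0 : ℝ) ≤ n := Nat.cast_nonneg n
        linarith
      linarith
    obtain ⟨r, ⟨c, hc, rfl⟩, hr⟩ := exists_lt_of_csInf_lt hSne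
      (show sInf S < γ * (1 + κ ^ 2 / 3) by rw [← hγ]; nlinarith [sq_pos_of_pos hκ0])
    set b0 := ((γ⁻¹ : ℝ) : ℂ) • (star c * b * α c) with hb0
    have low : KiLow α b0 := by
      intro d hd
      have e : star d * b0 * α d = ((γ⁻¹ : ℝ) : ℂ) • (star (c * d) * b * α (c * d)) := by
        rw [hb0]; simp only [star_mul, map_mul, smul_mul_assoc, mul_smul_comm, mul_assoc]
      rw [e, norm_smul, Complex.norm_real, Real.norm_of_nonneg (by positivity)]
      have := hγle (c * d) (ki_iso_mul hc hd)
      rw [inv_mul_eq_div, le_div_iff₀ hγ0]; linarith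
    have nb : ‖b0‖ ≤ 1 + κ ^ 2 / 3 := by
      rw [hb0, norm_smul, Complex.norm_real, Real.norm_of_nonneg (by positivity)]
      rw [inv_mul_eq_div, div_le_iff₀ hγ0]; linarith
    have nb2 : ‖b0‖ ^ 2 ≤ 1 + κ ^ 2 := by
      have : κ ^ 2 ≤ 1 := by nlinarith
      nlinarith [norm_nonneg b0, sq_nonneg κ]
    obtain ⟨u, h1, h2, h3, h4⟩ := ki_low_u hpi low hκ0.le hκ1 nb2 hs ht hst
    have e16 : 16 * κ = (80 * ((n : ℝ) + 1))⁻¹ := by rw [hκ]; ring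
    rw [e16] at h3
    rw [e16] at h4
    exact ⟨u, h1, h2, h3, h4⟩
  choose u h1 h2 h3 h4 using main
  have t0 : Filter.Tendsto (fun n : ℕ => 1 / ((n : ℝ) + 1)) Filter.atTop (nhds 0) :=
    tendsto_one_div_add_atTop_nhds_zero_nat
  obtain ⟨k, z, hz, hk, hlim⟩ := ki_limit u (fun n => (1 / ((n : ℝ) + 1)) / 4)
    (by simpa using t0.div_const 4)
    (by
      intro n
      have : 1 / ((n : ℝ) + 1) ≤ 1 := by
        rw [div_le_one (by positivity)]
        have : (0 : ℝ) ≤ n := Nat.cast_nonneg n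
        linarith
      show (1 / ((n : ℝ) + 1)) / 4 ≤ 1 / 4
      linarith) h1 h2
    (by
      intro n m
      obtain ⟨l, hl⟩ := ki_pair hpi α (h2 n) (h2 m) (h4 n) (h4 m) (h3 m)
      refine ⟨l, hl.trans (le_of_eq ?_)⟩
      simp only [mul_inv]
      ring)
  refine ki_inner hpi α hz (ki_four_zero α z ?_)
  intro y hy
  have l1 : Filter.Tendsto (fun n => y * (k n • u n) - (k n • u n) * α y) Filter.atTop
      (nhds (y * z - z * α y)) := (hlim.const_mul y).sub (hlim.mul_const (α y))
  have l2 : Filter.Tendsto (fun n => y * (k n • u n) - (k n • u n) * α y) Filter.atTop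
      (nhds 0) := by
    apply squeeze_zero_norm (a := fun n : ℕ => 1 / ((n : ℝ) + 1)) _ t0
    intro n
    rw [mul_smul_comm, smul_mul_assoc, ← smul_sub, norm_smul]
    calc _ ≤ 5 * (80 * ((n : ℝ) + 1))⁻¹ :=
          mul_le_mul (hk n) (h4 n y hy) (norm_nonneg _) (by norm_num)
      _ = (1 / ((n : ℝ) + 1)) / 16 := by rw [mul_inv]; ring
      _ ≤ 1 / ((n : ℝ) + 1) := div_le_self (by positivity) (by norm_num)
  exact sub_eq_zero.1 (tendsto_nhds_unique l1 l2)

lemma ki_K1_list [Nontrivial A] (hpi : ∀ a : A, a ≠ 0 → ∃ x y : A, x * a * y = 1)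
    {s t : A} (hs : star s * s = 1) (ht : star t * t = 1) (hst : star s * t = 0)
    {ε : ℝ} (hε : 0 < ε) (L : List ((A ≃⋆ₐ[ℂ] A) × A)) (hL : ∀ p ∈ L, ¬ IsInnerAut p.1) :
    ∃ c : A, star c * c = 1 ∧ ∀ p ∈ L, ‖star c * p.2 * p.1 c‖ < ε := by
  induction L with
  | nil => exact ⟨1, by simp, by simp⟩
  | cons q L ih =>
    obtain ⟨c, hc, hcL⟩ := ih (fun p hp => hL p (List.mem_cons_of_mem _ hp))
    obtain ⟨d, hd, hdq⟩ := ki_K1 hpi hs ht hst q.1 (hL q List.mem_cons_self)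
      (star c * q.2 * q.1 c) hε
    refine ⟨c * d, ki_iso_mul hc hd, ?_⟩
    intro p hp
    have e : ∀ p : (A ≃⋆ₐ[ℂ] A) × A, star (c * d) * p.2 * p.1 (c * d)
        = star d * (star c * p.2 * p.1 c) * p.1 d := by
      intro p; simp only [star_mul, map_mul, mul_assoc]
    rw [e]
    rcases List.mem_cons.1 hp with rfl | hp
    · exact hdq
    · refine lt_of_le_of_lt ?_ (hcL p hp)
      have n1 := norm_mul_le (star d * (star c * p.2 * p.1 c)) (p.1 d)
      have n2 := norm_mul_le (star d) (star c * p.2 * p.1 c)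
      rw [norm_star] at n2
      have n3 := ki_iso_norm hd
      have n4 := ki_iso_norm (ki_iso_map p.1 hd)
      have n5 := norm_nonneg (star c * p.2 * p.1 c)
      have n6 := norm_nonneg (star d * (star c * p.2 * p.1 c))
      nlinarith
end Part3

section Part4
variable {A : Type} [CStarAlgebra A]

lemma ki_pow_add (β : A ≃⋆ₐ[ℂ] A) (i j : ℕ) (x : A) : (β ^ (i + j)) x = (β ^ i) ((β ^ j) x) := by
  rw [pow_add]; rfl

lemma ki_pow_succ (β : A ≃⋆ₐ[ℂ] A) (i : ℕ) (x : A) : (β ^ (i + 1)) x = β ((β ^ i) x) := by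
  rw [pow_succ']; rfl

lemma ki_pow_zero (β : A ≃⋆ₐ[ℂ] A) (x : A) : (β ^ 0) x = x := by
  rw [pow_zero]; rfl

lemma ki_cont (β : A ≃⋆ₐ[ℂ] A) : Continuous β :=
  (AddMonoidHomClass.isometry_of_norm β (ki_norm_map β)).continuous

lemma ki_map_exp (β : A ≃⋆ₐ[ℂ] A) (x : A) : β (NormedSpace.exp x) = NormedSpace.exp (β x) := by
  have h1 := (NormedSpace.exp_series_hasSum_exp' (𝕂 := ℂ) x).map β (ki_cont β)
  have h2 := NormedSpace.exp_series_hasSum_exp' (𝕂 := ℂ) (β x)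
  refine h1.unique ?_
  convert h2 using 2 with n
  simp [map_smul, map_pow]

lemma ki_exp (X V : A) (l : ℂ) {M : ℝ} (hM : 1 ≤ M) (hX : ‖X‖ ≤ M) (hl : ‖l‖ ≤ M) :
    ‖NormedSpace.exp X * V - Complex.exp l • V‖ ≤ Real.exp (2 * M) * ‖X * V - l • V‖ := by
  have hk : ∀ k : ℕ, ‖X ^ k * V - l ^ k • V‖ ≤ k * M ^ k * ‖X * V - l • V‖ := by
    intro k
    induction k with
    | zero => simp
    | succ k ih =>
      have e : X ^ (k + 1) * V - l ^ (k + 1) • V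
          = X ^ k * (X * V - l • V) + l • (X ^ k * V - l ^ k • V) := by
        rw [pow_succ, pow_succ', mul_sub, smul_sub, mul_smul_comm, smul_smul, mul_assoc]; abel
      have hXk : ‖X ^ k * (X * V - l • V)‖ ≤ M ^ k * ‖X * V - l • V‖ := by
        clear ih e
        induction k with
        | zero => simp
        | succ k ih =>
          rw [pow_succ', mul_assoc, pow_succ', mul_assoc]
          exact (norm_mul_le _ _).trans (mul_le_mul hX ih (norm_nonneg _) (by linarith))
      rw [e]
      refine (norm_add_le _ _).trans ?_
      rw [norm_smul]
      have h1 : ‖l‖ * ‖X ^ k * V - l ^ k • V‖ ≤ M * (k * M ^ k * ‖X * V - l • V‖) :=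
        mul_le_mul hl ih (norm_nonneg _) (by linarith)
      have h2 : M ^ k * ‖X * V - l • V‖ ≤ M ^ (k + 1) * ‖X * V - l • V‖ := by
        gcongr
        exact Nat.le_succ k
      push_cast
      have h3 : ((k : ℝ) + 1) * M ^ (k + 1) * ‖X * V - l • V‖
         = M * (k * M ^ k * ‖X * V - l • V‖) + M ^ (k + 1) * ‖X * V - l • V‖ := by ring
      rw [h3]; linarith
  have s1 := (NormedSpace.exp_series_hasSum_exp' (𝕂 := ℂ) X).mul_right V
  have s2 := (NormedSpace.exp_series_hasSum_exp' (𝕂 := ℂ) l).smul_const V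
  rw [← Complex.exp_eq_exp_ℂ] at s2
  have s3 := (NormedSpace.exp_series_hasSum_exp' (𝕂 := ℝ) (2 * M)).mul_right ‖X * V - l • V‖
  rw [← Real.exp_eq_exp_ℝ] at s3
  refine (s1.sub s2).norm_le_of_bounded s3 ?_
  intro k
  have e : ((k.factorial : ℂ)⁻¹ • X ^ k) * V - ((k.factorial : ℂ)⁻¹ • l ^ k) • V
      = (k.factorial : ℂ)⁻¹ • (X ^ k * V - l ^ k • V) := by
    rw [smul_sub, smul_mul_assoc, smul_assoc]
  rw [e, norm_smul, norm_inv, Complex.norm_natCast, smul_eq_mul, mul_assoc]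
  gcongr
  refine (hk k).trans ?_
  rw [mul_pow]
  gcongr
  exact_mod_cast Nat.lt_two_pow_self.le

lemma ki_H_kill (V : ℕ → A) (n k : ℕ) (hV : ∀ i, star (V i) * V i = 1) {ε : ℝ} (Z : A)
    (hZ : ∀ j < n, ‖star (V (j + k)) * Z‖ ≤ ε) :
    ‖(∑ j ∈ Finset.range n, V (j + k) * star (V (j + k))) * Z‖ ≤ n * ε := by
  rw [Finset.sum_mul]
  refine (norm_sum_le _ _).trans ?_
  calc _ ≤ ∑ j ∈ Finset.range n, ε := by
        apply Finset.sum_le_sum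
        intro j hj
        rw [mul_assoc]
        refine (norm_mul_le _ _).trans ?_
        have := hZ j (Finset.mem_range.1 hj)
        nlinarith [ki_iso_norm (hV (j + k)), norm_nonneg (star (V (j + k)) * Z), norm_nonneg (V (j + k))]
    _ = _ := by simp

lemma ki_H_fix (V : ℕ → A) (n k l : ℕ) (hV : ∀ i, star (V i) * V i = 1) {ε : ℝ} (hε : 0 ≤ ε)
    (hl : ∃ j < n, j + k = l) (hZ : ∀ j < n, j + k ≠ l → ‖star (V (j + k)) * V l‖ ≤ ε) :
    ‖(∑ j ∈ Finset.range n, V (j + k) * star (V (j + k))) * V l - V l‖ ≤ n * ε := by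
  obtain ⟨i, hi, rfl⟩ := hl
  rw [Finset.sum_mul, ← Finset.add_sum_erase _ _ (Finset.mem_range.2 hi), mul_assoc, hV, mul_one,
    add_sub_cancel_left]
  refine (norm_sum_le _ _).trans ?_
  calc _ ≤ ∑ j ∈ (Finset.range n).erase i, ε := by
        apply Finset.sum_le_sum
        intro j hj
        rw [Finset.mem_erase, Finset.mem_range] at hj
        rw [mul_assoc]
        refine (norm_mul_le _ _).trans ?_
        have := hZ j hj.2 (by omega)
        nlinarith [ki_iso_norm (hV (j + k)), norm_nonneg (star (V (j + k)) * V (i + k)),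
          norm_nonneg (V (j + k))]
    _ ≤ ∑ j ∈ (Finset.range n), ε :=
        Finset.sum_le_sum_of_subset_of_nonneg (Finset.erase_subset _ _) (fun _ _ _ => hε)
    _ = _ := by simp

lemma ki_H_norm (V : ℕ → A) (n : ℕ) (hV : ∀ i, star (V i) * V i = 1) {ε : ℝ} (hε : 0 ≤ ε)
    (hn : (n : ℝ) * (n * ε) ≤ 2)
    (hZ : ∀ j < n, ∀ l < n, j ≠ l → ‖star (V j) * V l‖ ≤ ε) :
    ‖(∑ j ∈ Finset.range n, V j * star (V j))‖ ≤ 2 := by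
  set H := ∑ j ∈ Finset.range n, V j * star (V j) with hH
  have hs : star H = H := by rw [hH, star_sum]; simp
  have h1 : ∀ l < n, ‖H * V l - V l‖ ≤ n * ε := fun l hl =>
    ki_H_fix V n 0 l hV hε ⟨l, hl, rfl⟩ (fun j hj hjl => hZ j hj l hl hjl)
  have e : H * H - H = ∑ l ∈ Finset.range n, (H * V l - V l) * star (V l) := by
    simp only [sub_mul, Finset.sum_sub_distrib, mul_assoc, ← Finset.mul_sum]
    rw [← hH]
  have h2 : ‖H * H - H‖ ≤ n * (n * ε) := by
    rw [e]
    refine (norm_sum_le _ _).trans ?_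
    calc _ ≤ ∑ l ∈ Finset.range n, (n * ε : ℝ) := by
          apply Finset.sum_le_sum
          intro l hl
          refine (norm_mul_le _ _).trans ?_
          rw [norm_star]
          have := h1 l (Finset.mem_range.1 hl)
          nlinarith [ki_iso_norm (hV l), norm_nonneg (H * V l - V l), norm_nonneg (V l)]
      _ = _ := by simp
  have h3 : ‖H * H‖ = ‖H‖ * ‖H‖ := by
    have := CStarRing.norm_star_mul_self (x := H)
    rwa [hs] at this
  have h4 := norm_sub_norm_le (H * H) H
  rw [h3] at h4
  nlinarith [norm_nonneg H]

/-- the cocycle -/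
def kiCoc (β : A ≃⋆ₐ[ℂ] A) (v : A) : ℕ → A
  | 0 => 1
  | k + 1 => kiCoc β v k * (β ^ k) v

lemma kiCoc_unitary (β : A ≃⋆ₐ[ℂ] A) {v : A} (hv : v ∈ unitary A) (k : ℕ) :
    kiCoc β v k ∈ unitary A := by
  induction k with
  | zero => exact one_mem _
  | succ k ih =>
    refine mul_mem ih ?_
    rw [Unitary.mem_iff] at hv ⊢
    rw [← map_star, ← map_mul, ← map_mul, hv.1, hv.2, map_one]
    exact ⟨rfl, rfl⟩

lemma kiCoc_iter (β : A ≃⋆ₐ[ℂ] A) (v a : A) (k : ℕ) :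
    (fun x => v * β x * star v)^[k] a = kiCoc β v k * (β ^ k) a * star (kiCoc β v k) := by
  have hs : ∀ k, v * β (kiCoc β v k) = kiCoc β v (k + 1) := by
    intro k
    induction k with
    | zero => simp [kiCoc]
    | succ k ih =>
      rw [kiCoc, map_mul, ← mul_assoc, ih, ← ki_pow_succ]
      rfl
  induction k with
  | zero => simp [kiCoc]
  | succ k ih =>
    rw [Function.iterate_succ_apply', ih, ki_pow_succ, ← hs k]
    simp only [map_mul, map_star, star_mul, mul_assoc]

lemma kiCoc_fix (β : A ≃⋆ₐ[ℂ] A) {v : A} (hv : v ∈ unitary A) (V : A) (z : ℂ) (hz : ‖z‖ = 1)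
    {τ : ℝ} (n : ℕ) (h : ∀ k < n, ‖(β ^ k) v * V - z • V‖ ≤ τ) (k : ℕ) (hk : k ≤ n) :
    ‖kiCoc β v k * V - z ^ k • V‖ ≤ k * τ := by
  induction k with
  | zero => simp [kiCoc]
  | succ k ih =>
    have e : kiCoc β v (k + 1) * V - z ^ (k + 1) • V
        = kiCoc β v k * ((β ^ k) v * V - z • V) + z • (kiCoc β v k * V - z ^ k • V) := by
      rw [kiCoc, pow_succ', mul_sub, smul_sub, mul_smul_comm, smul_smul, mul_assoc]; abel
    rw [e]
    refine (norm_add_le _ _).trans ?_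
    rw [norm_smul, hz, one_mul]
    have h1 := ih (by omega)
    have h2 := h k (by omega)
    have h3 := norm_mul_le (kiCoc β v k) ((β ^ k) v * V - z • V)
    have h4 := ki_iso_norm (Unitary.mem_iff.1 (kiCoc_unitary β hv k)).1
    push_cast
    nlinarith [norm_nonneg ((β ^ k) v * V - z • V)]

lemma kiCoc_star (β : A ≃⋆ₐ[ℂ] A) {v : A} (hv : v ∈ unitary A) (Q : A)
    {τ : ℝ} (n : ℕ) (h : ∀ k < n, ‖(β ^ k) v * Q - Q‖ ≤ τ) (k : ℕ) (hk : k ≤ n) :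
    ‖star (kiCoc β v k) * Q - Q‖ ≤ k * τ := by
  induction k with
  | zero => simp [kiCoc]
  | succ k ih =>
    set w := (β ^ k) v with hw
    have hvv := ki_iso_map (β ^ k) (Unitary.mem_iff.1 hv).1
    rw [← hw] at hvv
    have e : star (kiCoc β v (k + 1)) * Q - Q
        = star w * (star (kiCoc β v k) * Q - Q) - star w * (w * Q - Q) := by
      rw [kiCoc, star_mul, mul_sub, mul_sub, ← mul_assoc (star w) w, hvv, one_mul, mul_assoc, ← hw]
      abel
    rw [e]
    refine (norm_sub_le _ _).trans ?_
    have h1 := ih (by omega)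
    have h2 := h k (by omega)
    have h3 := norm_mul_le (star w) (star (kiCoc β v k) * Q - Q)
    have h3' := norm_mul_le (star w) (w * Q - Q)
    have h4 := ki_iso_norm hvv
    rw [norm_star] at h3 h3'
    push_cast
    nlinarith [norm_nonneg (w * Q - Q), norm_nonneg (star (kiCoc β v k) * Q - Q)]

end Part4

section Part4b
variable {A : Type} [CStarAlgebra A]

lemma ki_nle {x y : A} {k : ℝ} (hx : ‖x‖ ≤ 1) (hy : ‖y‖ ≤ k) : ‖x * y‖ ≤ k := by
  have := norm_mul_le x y
  nlinarith [norm_nonneg x, norm_nonneg y]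

lemma ki_nle' {x y : A} {k : ℝ} (hx : ‖x‖ ≤ k) (hy : ‖y‖ ≤ 1) : ‖x * y‖ ≤ k := by
  have := norm_mul_le x y
  nlinarith [norm_nonneg x, norm_nonneg y]

lemma ki_final [Nontrivial A] {w a x V Q : A} (hw : w ∈ unitary A) {s t σ ρ : ℝ} (hV : ‖V‖ ≤ 1) (hQ : ‖Q‖ ≤ 1)
    (h1 : ‖w * V + V‖ ≤ σ) (h2 : ‖star w * Q - Q‖ ≤ σ)
    (h3 : ‖(2 : ℂ) • (star Q * a * V) - ((s - t : ℝ) : ℂ) • (1 : A)‖ ≤ ρ) :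
    |s - t| ≤ ‖w * x * star w - a‖ + ‖x - a‖ + 2 * σ * ‖a‖ + ρ := by
  obtain ⟨w1, w2⟩ := Unitary.mem_iff.1 hw
  have wn := ki_iso_norm w1
  have wsn : ‖star w‖ ≤ 1 := by rwa [norm_star]
  have hσ : 0 ≤ σ := (norm_nonneg _).trans h1
  have hQs : ‖star Q‖ ≤ 1 := by rwa [norm_star]
  have c1 : ‖w * a - a * w‖ ≤ ‖w * x * star w - a‖ + ‖x - a‖ := by
    have e : w * a - a * w = (w * x * star w - a) * w - w * (x - a) := by
      simp only [sub_mul, mul_sub, mul_assoc, w1, mul_one]; abel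
    rw [e]
    exact (norm_sub_le _ _).trans (add_le_add (ki_nle' le_rfl wn) (ki_nle wn le_rfl))
  have e2 : ((s - t : ℝ) : ℂ) • (1 : A) = star Q * (w * a - a * w) * V
      - star (star w * Q - Q) * (a * V) + star Q * (a * (w * V + V))
      - ((2 : ℂ) • (star Q * a * V) - ((s - t : ℝ) : ℂ) • (1 : A)) := by
    have : (2 : ℂ) • (star Q * a * V) = star Q * (w * a - a * w) * V
      - star (star w * Q - Q) * (a * V) + star Q * (a * (w * V + V)) := by
      rw [two_smul]
      simp only [star_sub, star_mul, star_star, sub_mul, mul_sub, mul_add, mul_assoc]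
      abel
    rw [← this]; abel
  have e3 : ‖((s - t : ℝ) : ℂ) • (1 : A)‖ = |s - t| := by
    rw [norm_smul, norm_one, mul_one, Complex.norm_real, Real.norm_eq_abs]
  rw [← e3, e2]
  have b1 : ‖star Q * (w * a - a * w) * V‖ ≤ ‖w * x * star w - a‖ + ‖x - a‖ :=
    ki_nle' (ki_nle hQs c1) hV
  have b2 : ‖star (star w * Q - Q) * (a * V)‖ ≤ σ * ‖a‖ := by
    refine (norm_mul_le _ _).trans ?_
    rw [norm_star]
    exact mul_le_mul h2 (ki_nle' le_rfl hV) (norm_nonneg _) hσ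
  have b3 : ‖star Q * (a * (w * V + V))‖ ≤ σ * ‖a‖ := by
    refine ki_nle hQs ((norm_mul_le _ _).trans ?_)
    nlinarith [norm_nonneg a]
  refine (norm_sub_le _ _).trans ?_
  have t1 := norm_add_le (star Q * (w * a - a * w) * V
      - star (star w * Q - Q) * (a * V)) (star Q * (a * (w * V + V)))
  have t2 := norm_sub_le (star Q * (w * a - a * w) * V) (star (star w * Q - Q) * (a * V))
  linarith

lemma ki_off (β : A ≃⋆ₐ[ℂ] A) {X Y : A} {N : ℕ} {ε : ℝ}
    (h1 : ∀ i, 1 ≤ i → i ≤ N → ‖star X * (β ^ i) Y‖ ≤ ε)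
    (h2 : ∀ i, 1 ≤ i → i ≤ N → ‖star Y * (β ^ i) X‖ ≤ ε) (i l : ℕ) (hi : i ≤ N) (hl : l ≤ N)
    (hil : i ≠ l) : ‖star ((β ^ i) X) * (β ^ l) Y‖ ≤ ε := by
  have key : ∀ (X Y : A) (i d : ℕ), ‖star ((β ^ i) X) * (β ^ (i + d)) Y‖ = ‖star X * (β ^ d) Y‖ := by
    intro X Y i d
    rw [ki_pow_add, ← map_star, ← map_mul, ki_norm_map]
  rcases lt_or_gt_of_ne hil with h | h
  · obtain ⟨d, rfl⟩ := Nat.exists_eq_add_of_lt h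
    rw [add_assoc, key]
    exact h1 _ (by omega) (by omega)
  · obtain ⟨d, rfl⟩ := Nat.exists_eq_add_of_lt h
    rw [← norm_star, star_mul, star_star, add_assoc, key]
    exact h2 _ (by omega) (by omega)

lemma kiCoc_one (β : A ≃⋆ₐ[ℂ] A) (k : ℕ) : kiCoc β 1 k = 1 := by
  induction k with
  | zero => rfl
  | succ k ih => rw [kiCoc, ih, map_one, one_mul]

lemma ki_WQ {c d : A} (hc : star c * c = 1) (hd : star d * d = 1) (hcd : star c * d = 0) :
    star (((Real.sqrt 2)⁻¹ : ℂ) • (c + d)) * (((Real.sqrt 2)⁻¹ : ℂ) • (c + d)) = 1 ∧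
    star (((Real.sqrt 2)⁻¹ : ℂ) • (c - d)) * (((Real.sqrt 2)⁻¹ : ℂ) • (c - d)) = 1 ∧
    star (((Real.sqrt 2)⁻¹ : ℂ) • (c + d)) * (((Real.sqrt 2)⁻¹ : ℂ) • (c - d)) = 0 := by
  have hdc : star d * c = 0 := by simpa using congrArg star hcd
  have r2 : ((Real.sqrt 2)⁻¹ : ℂ) * ((Real.sqrt 2)⁻¹ : ℂ) = 1 / 2 := by
    rw [← mul_inv, ← Complex.ofReal_mul, Real.mul_self_sqrt (by norm_num)]; norm_num
  have hstar : star ((Real.sqrt 2)⁻¹ : ℂ) = ((Real.sqrt 2)⁻¹ : ℂ) := by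
    rw [← Complex.ofReal_inv]; simp
  simp only [star_smul, hstar, smul_mul_smul_comm, r2, star_add, star_sub, mul_add, add_mul,
    mul_sub, sub_mul, hc, hd, hcd, hdc]
  refine ⟨?_, ?_, ?_⟩
  · module
  · module
  · module

lemma ki_WaQ {a c d : A} (hc : star c * c = 1) (hd : star d * d = 1) (hcd : star c * d = 0)
    {s t ε : ℝ} (h1 : ‖a * c - (s : ℂ) • c‖ ≤ ε) (h2 : ‖a * d - (t : ℂ) • d‖ ≤ ε) {m : A}
    (hm : star m * m = 1) :
    ‖(2 : ℂ) • (star ((((Real.sqrt 2)⁻¹ : ℂ) • (c - d)) * m) * a * ((((Real.sqrt 2)⁻¹ : ℂ) • (c + d)) * m))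
      - ((s - t : ℝ) : ℂ) • (1 : A)‖ ≤ 4 * ε := by
  have hdc : star d * c = 0 := by simpa using congrArg star hcd
  have r2 : ((Real.sqrt 2)⁻¹ : ℂ) * ((Real.sqrt 2)⁻¹ : ℂ) = 1 / 2 := by
    rw [← mul_inv, ← Complex.ofReal_mul, Real.mul_self_sqrt (by norm_num)]; norm_num
  have hstar : star ((Real.sqrt 2)⁻¹ : ℂ) = ((Real.sqrt 2)⁻¹ : ℂ) := by
    rw [← Complex.ofReal_inv]; simp
  set p := a * c - (s : ℂ) • c with hp
  set q := a * d - (t : ℂ) • d with hq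
  have hac : a * c = p + (s : ℂ) • c := by rw [hp]; abel
  have had : a * d = q + (t : ℂ) • d := by rw [hq]; abel
  have e0 : star (c - d) * (a * (c + d)) = star (c - d) * (p + q) + ((s - t : ℝ) : ℂ) • (1 : A) := by
    rw [mul_add a, hac, had]
    simp only [star_sub, mul_add, sub_mul, mul_smul_comm, hc, hd, hcd, hdc]
    push_cast
    module
  have e : (2 : ℂ) • (star ((((Real.sqrt 2)⁻¹ : ℂ) • (c - d)) * m) * a * ((((Real.sqrt 2)⁻¹ : ℂ) • (c + d)) * m))
      - ((s - t : ℝ) : ℂ) • (1 : A) = star m * (star (c - d) * (p + q)) * m := by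
    have e1 : star ((((Real.sqrt 2)⁻¹ : ℂ) • (c - d)) * m) * a * ((((Real.sqrt 2)⁻¹ : ℂ) • (c + d)) * m)
       = (1 / 2 : ℂ) • (star m * (star (c - d) * (a * (c + d))) * m) := by
      rw [← r2, star_mul, star_smul, hstar]
      simp only [smul_mul_assoc, mul_smul_comm, smul_smul, mul_assoc]
    rw [e1, e0, smul_smul, mul_add, add_mul, mul_smul_comm, mul_one, smul_mul_assoc, hm]
    norm_num
  rw [e]
  have cn := ki_iso_norm hc
  have dn := ki_iso_norm hd
  have mn := ki_iso_norm hm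
  refine ki_nle' (ki_nle (by rwa [norm_star]) ?_) mn
  refine (norm_mul_le _ _).trans ?_
  rw [norm_star]
  have n1 := norm_sub_le c d
  have n2 := norm_add_le p q
  nlinarith [norm_nonneg (c - d), norm_nonneg (p + q)]

variable [PartialOrder A] [StarOrderedRing A]

lemma ki_density [Nontrivial A] (hpi : ∀ a : A, a ≠ 0 → ∃ x y : A, x * a * y = 1)
    {p q : A} (hp : star p * p = 1) (hq : star q * q = 1) (hpq : star p * q = 0)
    (β : A ≃⋆ₐ[ℂ] A) (hβ : ∀ i : ℕ, 0 < i → ¬ IsInnerAut (β ^ i)) {a : A} (ha : IsSelfAdjoint a)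
    {s t : ℝ} (hs : s ∈ spectrum ℝ a) (ht : t ∈ spectrum ℝ a) (hst : s ≠ t) {δ : ℝ} (hδ : 0 < δ) :
    ∃ v ∈ unitary A, ‖v - 1‖ < δ ∧
      ∃ n : ℕ, |s - t| / 4 ≤ ‖(fun x => v * β x * star v)^[n] a - a‖ := by
  by_cases hcase : ∃ n : ℕ, |s - t| / 4 ≤ ‖(β ^ n) a - a‖
  · obtain ⟨n, hn⟩ := hcase
    refine ⟨1, one_mem _, by simpa using hδ, n, ?_⟩
    rw [kiCoc_iter, kiCoc_one]
    simpa using hn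
  push Not at hcase
  have hD : 0 < |s - t| := abs_pos.2 (sub_ne_zero.2 hst)
  set D := |s - t| with hDdef
  set C := Real.exp 16 with hC
  have hC0 : 0 < C := Real.exp_pos _
  obtain ⟨N, hN⟩ := exists_nat_gt (C * 8 / δ)
  set n := N + 1 with hn
  have hn1 : (1 : ℝ) ≤ n := by rw [hn]; push_cast; linarith [(Nat.cast_nonneg N : (0 : ℝ) ≤ N)]
  have hnN : (N : ℝ) ≤ n := by rw [hn]; push_cast; linarith
  have hn0 : (0 : ℝ) < n := by linarith
  obtain ⟨c, d, hc, hd, hcd, hac, had⟩ := ki_exists_near_two hpi ha hs ht (ε := D / 16)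
    (by positivity) (by rw [← hDdef]; linarith)
  obtain ⟨hW, hQ, hWQ⟩ := ki_WQ hc hd hcd
  set W' := ((Real.sqrt 2)⁻¹ : ℂ) • (c + d) with hW'
  set Q' := ((Real.sqrt 2)⁻¹ : ℂ) • (c - d) with hQ'
  set W := (β ^ N).symm W' with hWd
  set Q := (β ^ N).symm Q' with hQd
  have hβW : (β ^ N) W = W' := by rw [hWd]; simp
  have hβQ : (β ^ N) Q = Q' := by rw [hQd]; simp
  have hW1 : star W * W = 1 := ki_iso_map _ hW
  have hQ1 : star Q * Q = 1 := ki_iso_map _ hQ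
  have hWQ1 : star W * Q = 0 := by rw [hWd, hQd, ← map_star, ← map_mul, hWQ, map_zero]
  -- the small parameter
  set ε : ℝ := min 2 (D / (32 * C * (‖a‖ + 1))) / (n * n) with hε
  have ha1 : 0 < ‖a‖ + 1 := by positivity
  have hmin : 0 < min 2 (D / (32 * C * (‖a‖ + 1))) := lt_min (by norm_num) (by positivity)
  have hε0 : 0 < ε := by positivity
  have hεn : (n : ℝ) * (n * ε) = min 2 (D / (32 * C * (‖a‖ + 1))) := by
    rw [hε]; field_simp
  have hε2 : (n : ℝ) * (n * ε) ≤ 2 := by rw [hεn]; exact min_le_left _ _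
  have hε3 : (n : ℝ) * (n * ε) * (32 * C * (‖a‖ + 1)) ≤ D := by
    rw [hεn, ← le_div_iff₀ (by positivity)]; exact min_le_right _ _
  obtain ⟨m, hm, hmL⟩ := ki_K1_list hpi hp hq hpq hε0
    ((List.range (2 * n)).flatMap fun i => [(β ^ (i + 1), star W * (β ^ (i + 1)) W),
      (β ^ (i + 1), star Q * (β ^ (i + 1)) W), (β ^ (i + 1), star W * (β ^ (i + 1)) Q)])
    (by
      intro pr hpr
      simp only [List.mem_flatMap, List.mem_range, List.mem_cons, List.not_mem_nil, or_false] at hpr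
      obtain ⟨i, -, rfl | rfl | rfl⟩ := hpr <;> exact hβ _ (Nat.succ_pos i))
  have hpair : ∀ X Y : A, (∀ i < 2 * n, (β ^ (i + 1), star X * (β ^ (i + 1)) Y) ∈
      ((List.range (2 * n)).flatMap fun i => [(β ^ (i + 1), star W * (β ^ (i + 1)) W),
      (β ^ (i + 1), star Q * (β ^ (i + 1)) W), (β ^ (i + 1), star W * (β ^ (i + 1)) Q)])) →
      ∀ i, 1 ≤ i → i ≤ 2 * n → ‖star (X * m) * (β ^ i) (Y * m)‖ ≤ ε := by
    intro X Y hXY i hi1 hi2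
    obtain ⟨j, rfl⟩ := Nat.exists_eq_add_of_le' hi1
    have := hmL _ (hXY j (by omega))
    have e : star (X * m) * (β ^ (j + 1)) (Y * m)
        = star m * (star X * (β ^ (j + 1)) Y) * (β ^ (j + 1)) m := by
      simp only [star_mul, map_mul, mul_assoc]
    rw [e]
    exact this.le
  have pWW := hpair W W (fun i hi => by
    simp only [List.mem_flatMap, List.mem_range, List.mem_cons, List.not_mem_nil, or_false]
    exact ⟨i, hi, Or.inl rfl⟩)
  have pQW := hpair Q W (fun i hi => by
    simp only [List.mem_flatMap, List.mem_range, List.mem_cons, List.not_mem_nil, or_false]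
    exact ⟨i, hi, Or.inr (Or.inl rfl)⟩)
  have pWQ := hpair W Q (fun i hi => by
    simp only [List.mem_flatMap, List.mem_range, List.mem_cons, List.not_mem_nil, or_false]
    exact ⟨i, hi, Or.inr (Or.inr rfl)⟩)
  set V := fun j : ℕ => (β ^ j) (W * m) with hV
  set Z := (β ^ N) (Q * m) with hZ
  have hV1 : ∀ i, star (V i) * V i = 1 := fun i => ki_iso_map _ (ki_iso_mul hW1 hm)
  have hZ1 : star Z * Z = 1 := ki_iso_map _ (ki_iso_mul hQ1 hm)
  have offV : ∀ i l, i ≤ 2 * n → l ≤ 2 * n → i ≠ l → ‖star (V i) * V l‖ ≤ ε :=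
    fun i l hi hl hil => ki_off β pWW pWW i l hi hl hil
  have offZ : ∀ i, i ≤ 2 * n → ‖star (V i) * Z‖ ≤ ε := by
    intro i hi
    by_cases hiN : i = N
    · subst hiN
      rw [hV, hZ]
      have : star ((β ^ i) (W * m)) * (β ^ i) (Q * m) = 0 := by
        rw [← map_star, ← map_mul, star_mul, mul_assoc, ← mul_assoc (star W), hWQ1]
        simp
      simp only [this, norm_zero]
      exact hε0.le
    · exact ki_off β pWQ pQW i N hi (by omega) hiN
  set H := ∑ j ∈ Finset.range n, V j * star (V j) with hH
  have hHs : IsSelfAdjoint H := by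
    rw [IsSelfAdjoint, hH, star_sum]; simp
  have hHn : ‖H‖ ≤ 2 := ki_H_norm V n hV1 hε0.le hε2
    (fun j hj l hl hjl => offV j l (by omega) (by omega) hjl)
  have hHk : ∀ k, (β ^ k) H = ∑ j ∈ Finset.range n, V (j + k) * star (V (j + k)) := by
    intro k
    rw [hH, map_sum]
    refine Finset.sum_congr rfl fun j _ => ?_
    rw [map_mul, map_star, hV]
    simp only [add_comm j k, ki_pow_add]
  have hfix : ∀ k < n, ‖(β ^ k) H * V N - V N‖ ≤ n * ε := by
    intro k hk
    rw [hHk]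
    exact ki_H_fix V n k N hV1 hε0.le ⟨N - k, by omega, by omega⟩
      (fun j hj hjN => offV _ _ (by omega) (by omega) hjN)
  have hkill : ∀ k < n, ‖(β ^ k) H * Z‖ ≤ n * ε := by
    intro k hk
    rw [hHk]
    exact ki_H_kill V n k hV1 Z (fun j hj => offZ _ (by omega))
  -- the unitary
  set θ : ℝ := Real.pi / n with hθ
  have hθ0 : 0 ≤ θ := by have := Real.pi_pos; positivity
  have hθn : θ ≤ 4 / n := by rw [hθ]; gcongr; exact Real.pi_le_four
  have hθ4 : θ ≤ 4 := hθn.trans (div_le_self (by norm_num) hn1)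
  have hln : ‖Complex.I * (θ : ℂ)‖ = θ := by
    rw [norm_mul, Complex.norm_I, one_mul, Complex.norm_real, Real.norm_of_nonneg hθ0]
  set v : A := NormedSpace.exp ((Complex.I * (θ : ℂ)) • H) with hv
  have hvu : v ∈ unitary A := by
    have hsa : IsSelfAdjoint (θ • H) := by
      rw [IsSelfAdjoint, star_smul, hHs.star_eq]; simp
    have := (selfAdjoint.expUnitary ⟨θ • H, hsa⟩).2
    rw [selfAdjoint.expUnitary_coe] at this
    have e : Complex.I • (θ • H) = (Complex.I * (θ : ℂ)) • H := by
      rw [mul_smul, Complex.coe_smul]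
    simp only [e] at this
    exact this
  have hXn : ∀ k, ‖(Complex.I * (θ : ℂ)) • (β ^ k) H‖ ≤ 8 / n := by
    intro k
    rw [norm_smul, hln, ki_norm_map]
    calc θ * ‖H‖ ≤ 4 / n * 2 := mul_le_mul hθn hHn (norm_nonneg _) (by positivity)
      _ = 8 / n := by ring
  have h8 : (8 : ℝ) / n ≤ 8 := div_le_self (by norm_num) hn1
  have hvk : ∀ k, (β ^ k) v = NormedSpace.exp ((Complex.I * (θ : ℂ)) • (β ^ k) H) := by
    intro k; rw [hv, ki_map_exp, map_smul]
  have hCe : Real.exp (2 * 8) = C := by rw [hC]; norm_num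
  have hv1 : ‖v - 1‖ < δ := by
    have h0 := hXn 0
    rw [pow_zero] at h0
    have h0' : ‖(Complex.I * (θ : ℂ)) • H‖ ≤ 8 / n := h0
    have h1 := ki_exp ((Complex.I * (θ : ℂ)) • H) 1 0 (M := 8) (by norm_num) (h0'.trans h8) (by simp)
    rw [hCe] at h1
    simp only [mul_one, Complex.exp_zero, one_smul, zero_smul, sub_zero] at h1
    refine lt_of_le_of_lt (h1.trans (mul_le_mul_of_nonneg_left h0' hC0.le)) ?_
    rw [div_lt_iff₀ hδ] at hN
    rw [← mul_div_assoc, div_lt_iff₀ hn0]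
    nlinarith
  set τ : ℝ := C * (4 * (n * ε)) with hτ
  have hτV : ∀ k < n, ‖(β ^ k) v * V N - Complex.exp (Complex.I * θ) • V N‖ ≤ τ := by
    intro k hk
    rw [hvk]
    have h1 := ki_exp ((Complex.I * (θ : ℂ)) • (β ^ k) H) (V N) (Complex.I * θ) (M := 8)
      (by norm_num) ((hXn k).trans h8) (by rw [hln]; linarith)
    rw [hCe] at h1
    refine h1.trans ?_
    rw [smul_mul_assoc, ← smul_sub, norm_smul, hln]
    refine mul_le_mul_of_nonneg_left ?_ hC0.le
    exact mul_le_mul hθ4 (hfix k hk) (norm_nonneg _) (by norm_num)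
  have hτZ : ∀ k < n, ‖(β ^ k) v * Z - Z‖ ≤ τ := by
    intro k hk
    rw [hvk]
    have h1 := ki_exp ((Complex.I * (θ : ℂ)) • (β ^ k) H) Z 0 (M := 8)
      (by norm_num) ((hXn k).trans h8) (by simp)
    rw [hCe] at h1
    simp only [Complex.exp_zero, one_smul, zero_smul, sub_zero] at h1
    refine h1.trans ?_
    rw [smul_mul_assoc, norm_smul, hln]
    refine mul_le_mul_of_nonneg_left ?_ hC0.le
    exact mul_le_mul hθ4 (hkill k hk) (norm_nonneg _) (by norm_num)
  have hz1 : ‖Complex.exp (Complex.I * θ)‖ = 1 := by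
    rw [mul_comm]; exact Complex.norm_exp_ofReal_mul_I θ
  have r1 := kiCoc_fix β hvu (V N) _ hz1 n hτV n le_rfl
  have r2 := kiCoc_star β hvu Z n hτZ n le_rfl
  have hzn : Complex.exp (Complex.I * θ) ^ n = -1 := by
    rw [← Complex.exp_nat_mul, hθ]
    have : (n : ℂ) * (Complex.I * ((Real.pi / n : ℝ) : ℂ)) = Real.pi * Complex.I := by
      push_cast
      have : (n : ℂ) ≠ 0 := by exact_mod_cast hn0.ne'
      field_simp
    rw [this, Complex.exp_pi_mul_I]
  rw [hzn, neg_one_smul, sub_neg_eq_add] at r1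
  have hVN : V N = W' * (β ^ N) m := by simp only [hV]; rw [map_mul, hβW]
  have hZN : Z = Q' * (β ^ N) m := by rw [hZ, map_mul, hβQ]
  have r3 := ki_WaQ hc hd hcd hac had (ki_iso_map (β ^ N) hm)
  rw [← hW', ← hQ', ← hVN, ← hZN] at r3
  have r4 := ki_final (x := (β ^ n) a) (kiCoc_unitary β hvu n) (ki_iso_norm (hV1 N)) (ki_iso_norm hZ1) r1 r2 r3
  refine ⟨v, hvu, hv1, n, ?_⟩
  rw [kiCoc_iter]
  have r5 := hcase n
  rw [← hDdef] at r4
  have r6 : 2 * (n * τ) * ‖a‖ ≤ D / 4 := by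
    have e : 2 * (n * τ) * ‖a‖ = (n * (n * ε) * (32 * C)) * ‖a‖ / 4 := by rw [hτ]; ring
    rw [e]
    have : (n : ℝ) * (n * ε) * (32 * C) * ‖a‖ ≤ (n * (n * ε) * (32 * C)) * (‖a‖ + 1) := by
      gcongr; linarith
    linarith
  linarith
end Part4b

section Part5
variable {A : Type} [CStarAlgebra A]

/-- perturbation of an automorphism by a unitary -/
noncomputable def kiAd (u : unitary A) (α : A ≃⋆ₐ[ℂ] A) : A ≃⋆ₐ[ℂ] A := Unitary.conjStarAlgAut ℂ A u * α

lemma kiAd_apply (u : unitary A) (α : A ≃⋆ₐ[ℂ] A) (x : A) :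
    kiAd u α x = (u : A) * α x * star (u : A) := rfl

lemma kiAd_iter (u : unitary A) (α : A ≃⋆ₐ[ℂ] A) (n : ℕ) (x : A) :
    (kiAd u α ^ n) x = (fun x => (u : A) * α x * star (u : A))^[n] x := by
  induction n with
  | zero => rfl
  | succ n ih => rw [ki_pow_succ, ih, Function.iterate_succ_apply', kiAd_apply]

lemma kiAd_not_inner (u : unitary A) (α : A ≃⋆ₐ[ℂ] A) (n : ℕ) (h : ¬ IsInnerAut (α ^ n)) :
    ¬ IsInnerAut (kiAd u α ^ n) := by
  rintro ⟨w, hw, hwx⟩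
  apply h
  have hk := kiCoc_unitary α u.2 n
  set k := kiCoc α (u : A) n with hkd
  obtain ⟨k1, k2⟩ := Unitary.mem_iff.1 hk
  refine ⟨star k * w, mul_mem (Unitary.star_mem hk) hw, fun a => ?_⟩
  have h1 := hwx a
  rw [kiAd_iter, kiCoc_iter, ← hkd] at h1
  calc (α ^ n) a = (star k * k) * (α ^ n) a * (star k * k) := by rw [k1]; simp
    _ = star k * (k * (α ^ n) a * star k) * k := by simp only [mul_assoc]
    _ = star k * w * a * star (star k * w) := by
      rw [h1, star_mul, star_star]; simp only [mul_assoc]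

lemma ki_spread [Nontrivial A] {a : A} (ha : IsSelfAdjoint a) :
    ∃ s t : ℝ, s ∈ spectrum ℝ a ∧ t ∈ spectrum ℝ a ∧ ‖a - (s : ℂ) • (1 : A)‖ ≤ |s - t| := by
  obtain ⟨s, hs⟩ := ContinuousFunctionalCalculus.spectrum_nonempty (R := ℝ) a ha
  obtain ⟨t, ht, htn⟩ := (IsGreatest.norm_cfc (fun x : ℝ => x - s) a).1
  refine ⟨s, t, hs, ht, le_of_eq ?_⟩
  have e1 : a - (s : ℂ) • (1 : A) = cfc (fun x : ℝ => x - s) a := by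
    rw [cfc_sub (fun x : ℝ => x) (fun _ => s) a, cfc_id' ℝ a, cfc_const s a,
      Algebra.algebraMap_eq_smul_one, Complex.coe_smul]
  rw [e1, ← htn]
  show ‖t - s‖ = |s - t|
  rw [Real.norm_eq_abs, abs_sub_comm]

lemma ki_iter_cont (α : A ≃⋆ₐ[ℂ] A) (a : A) (n : ℕ) :
    Continuous (fun u : unitary A => (fun x => (u : A) * α x * star (u : A))^[n] a) := by
  induction n with
  | zero => exact continuous_const
  | succ n ih =>
    simp only [Function.iterate_succ_apply']
    have h1 := (ki_cont α).comp ih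
    exact (continuous_subtype_val.mul h1).mul (continuous_star.comp continuous_subtype_val)

variable [PartialOrder A] [StarOrderedRing A]

lemma ki_main [Nontrivial A] (hsep : TopologicalSpace.SeparableSpace A)
    (hpi : ∀ a : A, a ≠ 0 → ∃ x y : A, x * a * y = 1)
    {p q : A} (hp : star p * p = 1) (hq : star q * q = 1) (hpq : star p * q = 0)
    (α : A ≃⋆ₐ[ℂ] A) (hα : ∀ i : ℕ, 0 < i → ¬ IsInnerAut (α ^ i)) :
    ∃ u : unitary A, ∀ x : A, IsSelfAdjoint x → kiAd u α x = x → ∃ z : ℂ, z • (1 : A) = x := by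
  haveI : SecondCountableTopology A := UniformSpace.secondCountable_of_separable A
  haveI : CompleteSpace (unitary A) := (isClosed_unitary (R := A)).completeSpace_coe
  set d : ℕ → selfAdjoint A := TopologicalSpace.denseSeq (selfAdjoint A) with hd
  have hdd : DenseRange d := TopologicalSpace.denseRange_denseSeq _
  have hsp := fun k => ki_spread (d k).2
  choose s t hs ht hst using hsp
  set O : ℕ → Set (unitary A) := fun k => {u | s k ≠ t k → ∃ n : ℕ,
    |s k - t k| / 8 < ‖(fun x => (u : A) * α x * star (u : A))^[n] (d k : A) - (d k : A)‖} with hO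
  have hopen : ∀ k, IsOpen (O k) := by
    intro k
    by_cases h : s k = t k
    · have : O k = Set.univ := by
        ext u; simp [hO, h]
      rw [this]; exact isOpen_univ
    · have : O k = ⋃ n : ℕ, {u : unitary A | |s k - t k| / 8 <
          ‖(fun x => (u : A) * α x * star (u : A))^[n] (d k : A) - (d k : A)‖} := by
        ext u; simp [hO, h]
      rw [this]
      refine isOpen_iUnion fun n => ?_
      exact isOpen_lt continuous_const ((ki_iter_cont α (d k : A) n).sub continuous_const).norm
  have hdense : ∀ k, Dense (O k) := by
    intro k u
    rw [Metric.mem_closure_iff]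
    intro δ hδ
    by_cases h : s k = t k
    · exact ⟨u, fun h' => absurd h h', by simpa using hδ⟩
    obtain ⟨v, hv, hvδ, n, hn⟩ := ki_density hpi hp hq hpq (kiAd u α)
      (fun i hi => kiAd_not_inner u α i (hα i hi)) (d k).2 (hs k) (ht k) h hδ
    refine ⟨⟨v, hv⟩ * u, fun _ => ⟨n, ?_⟩, ?_⟩
    · have e : (fun x => (((⟨v, hv⟩ : unitary A) * u : unitary A) : A) * α x
          * star (((⟨v, hv⟩ : unitary A) * u : unitary A) : A))
          = fun x => v * kiAd u α x * star v := by
        funext x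
        rw [kiAd_apply]
        simp only [Submonoid.coe_mul, star_mul, mul_assoc]
      rw [e]
      have : 0 < |s k - t k| := abs_pos.2 (sub_ne_zero.2 h)
      linarith
    · rw [Subtype.dist_eq, dist_comm, dist_eq_norm]
      have e : (((⟨v, hv⟩ : unitary A) * u : unitary A) : A) - (u : A) = (v - 1) * (u : A) := by
        simp [sub_mul]
      rw [e]
      exact lt_of_le_of_lt (ki_nle' le_rfl (ki_iso_norm (Unitary.mem_iff.1 u.2).1)) hvδ
  obtain ⟨u, hu⟩ := (dense_iInter_of_isOpen hopen hdense).nonempty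
  rw [Set.mem_iInter] at hu
  refine ⟨u, fun x hx hfix => ?_⟩
  have happrox : ∀ ε > 0, ∃ r : ℂ, ‖x - r • (1 : A)‖ ≤ 17 * ε := by
    intro ε hε
    obtain ⟨k, hk⟩ := hdd.exists_dist_lt (⟨x, hx⟩ : selfAdjoint A) hε
    rw [Subtype.dist_eq, dist_eq_norm] at hk
    have hk' : ‖x - (d k : A)‖ < ε := hk
    refine ⟨(s k : ℂ), ?_⟩
    have hsk : |s k - t k| ≤ 16 * ε := by
      by_cases h : s k = t k
      · rw [h]; simp; linarith
      obtain ⟨n, hn⟩ := hu k h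
      rw [← kiAd_iter] at hn
      have hxn : (kiAd u α ^ n) x = x := by
        clear hn
        induction n with
        | zero => rfl
        | succ n ih => rw [ki_pow_succ, ih, hfix]
      have e : (kiAd u α ^ n) (d k : A) - (d k : A)
          = (x - (d k : A)) - (kiAd u α ^ n) (x - (d k : A)) := by
        rw [map_sub, hxn]; abel
      rw [e] at hn
      have h2 := norm_sub_le (x - (d k : A)) ((kiAd u α ^ n) (x - (d k : A)))
      rw [ki_norm_map] at h2
      linarith
    have e : x - (s k : ℂ) • (1 : A) = (x - (d k : A)) + ((d k : A) - (s k : ℂ) • (1 : A)) := by abel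
    rw [e]
    have h1 := norm_add_le (x - (d k : A)) ((d k : A) - (s k : ℂ) • (1 : A))
    linarith [hst k]
  have hcl : IsClosed ((Submodule.span ℂ {(1 : A)} : Submodule ℂ A) : Set A) :=
    Submodule.closed_of_finiteDimensional _
  have hmem : x ∈ closure ((Submodule.span ℂ {(1 : A)} : Submodule ℂ A) : Set A) := by
    rw [Metric.mem_closure_iff]
    intro ε hε
    obtain ⟨r, hr⟩ := happrox (ε / 34) (by positivity)
    refine ⟨r • (1 : A), Submodule.smul_mem _ _ (Submodule.mem_span_singleton_self _), ?_⟩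
    rw [dist_eq_norm]; linarith
  rw [hcl.closure_eq] at hmem
  exact Submodule.mem_span_singleton.1 hmem
end Part5

/-- Every aperiodic automorphism `α` of a unital Kirchberg algebra `A`
(`αⁿ` not inner for all `n ≠ 0`) can be perturbed by a unitary `u ∈ A` so that the
`ℤ`-action generated by `Ad u ∘ α` is ergodic, i.e. its fixed point algebra is `ℂ1`. -/
theorem aperiodic_automorphism_ergodic_perturbation
    (A : Type) [CStarAlgebra A] (hA : IsUnitalKirchberg A)
    (α : CStarAction (Multiplicative ℤ) A)
    (haper : ∀ n : ℤ, n ≠ 0 → ¬ IsInnerAut (α.app (Multiplicative.ofAdd n))) :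
    ∃ u : A, u ∈ unitary A ∧
      {a : A | u * α.app (Multiplicative.ofAdd 1) a * star u = a}
        = Set.range (fun z : ℂ => z • (1 : A)) := by
  have hne : Nontrivial A := by
    by_contra hnt
    rw [not_nontrivial_iff_subsingleton] at hnt
    exact haper 1 one_ne_zero ⟨1, one_mem _, fun a => Subsingleton.elim _ _⟩
  letI : PartialOrder A := CStarAlgebra.spectralOrder A
  haveI : StarOrderedRing A := CStarAlgebra.spectralOrderedRing A
  obtain ⟨p, q, hp, hq, hpq⟩ := hA.properly_infinite
  have hpow : ∀ i : ℕ, ∀ a : A, (α.app (Multiplicative.ofAdd 1) ^ i) a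
      = α.app (Multiplicative.ofAdd (i : ℤ)) a := by
    intro i
    induction i with
    | zero => intro a; exact (α.app_one a).symm
    | succ i ih =>
      intro a
      rw [ki_pow_succ, ih, ← α.app_mul, ← ofAdd_add]
      congr 3
      push_cast; ring
  obtain ⟨u, hu⟩ := ki_main hA.separable hA.purely_infinite hp hq hpq (α.app (Multiplicative.ofAdd 1))
    (by
      rintro i hi ⟨w, hw, hwa⟩
      refine haper i (by exact_mod_cast hi.ne') ⟨w, hw, fun a => ?_⟩
      rw [← hpow, hwa])
  refine ⟨u, u.2, ?_⟩
  ext x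
  simp only [Set.mem_setOf_eq, Set.mem_range]
  constructor
  · intro hx
    have hx1 : kiAd u (α.app (Multiplicative.ofAdd 1)) x = x := hx
    have hx2 : kiAd u (α.app (Multiplicative.ofAdd 1)) (star x) = star x := by
      rw [map_star, hx1]
    obtain ⟨z, hz⟩ := hu (realPart x : A) (realPart x).2 (by
      rw [realPart_apply_coe, ← Complex.coe_smul, map_smul, map_add, hx1, hx2])
    obtain ⟨w, hw⟩ := hu (imaginaryPart x : A) (imaginaryPart x).2 (by
      rw [imaginaryPart_apply_coe, ← Complex.coe_smul, map_smul, map_smul, map_sub, hx1, hx2])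
    refine ⟨z + Complex.I * w, ?_⟩
    rw [add_smul, mul_smul, hz, hw, realPart_add_I_smul_imaginaryPart]
  · rintro ⟨z, rfl⟩
    rw [map_smul, map_one, mul_smul_comm, mul_one, smul_mul_assoc, (Unitary.mem_iff.1 u.2).2]
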